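/- Let d ≥ 2 be an integer and let μ denote the Möbius function, with Möbius sequence u_n = μ(n) regarded as complex numbers. Let A ∈ GL(d, ℤ) be a matrix all of whose complex eigenvalues equal 1, or all of whose complex eigenvalues equal -1, and let a ∈ 𝕋^d = ℝ^d/ℤ^d with a ≠ 0, and define the affine distal flow T : 𝕋^d → 𝕋^d by T(x) = Ax + a. Then the Möbius sequence is linearly disjoint from T: for every continuous function f : 𝕋^d → ℂ and every x ∈ 𝕋^d, (1/N) ∑_{n=1}^{N} μ(n) · f(Tⁿ x) → 0 as N → ∞. -/

import Mathlib

open Filter Polynomial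

noncomputable section

/-- The `d`-torus `ℝ^d/ℤ^d`, as a product of copies of `ℝ/ℤ`. -/
abbrev Torus (d : ℕ) := Fin d → AddCircle (1 : ℝ)

/-- The affine map `x ↦ A x + a` on the `d`-torus, for an integer matrix `A`. -/
def torusAffine {d : ℕ} (A : Matrix (Fin d) (Fin d) ℤ) (a : Torus d) (x : Torus d) : Torus d :=
  fun i => (∑ j, A i j • x j) + a i

/-- `c` is a higher order oscillating sequence of order `m` (stronger version): for some
`λ > 1` the averages of `|c n|^λ` converge to a finite limit, and for every real-coefficient
polynomial `P` of degree at most `m` the averages of `c n · e^{2πi P(n)}` tend to `0`. -/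
def HigherOrderOscillating (c : ℕ → ℂ) (m : ℕ) : Prop :=
  (∃ lam : ℝ, 1 < lam ∧ ∃ K : ℝ,
    Tendsto (fun N : ℕ => (1 / N : ℝ) * ∑ n ∈ Finset.Icc 1 N, ‖c n‖ ^ lam) atTop (nhds K)) ∧
  ∀ P : Polynomial ℝ, P.degree ≤ m →
    Tendsto (fun N : ℕ => (1 / N : ℂ) * ∑ n ∈ Finset.Icc 1 N,
      c n * Complex.exp (2 * Real.pi * Complex.I * (P.eval (n : ℝ)))) atTop (nhds 0)

/-- `c` is linearly disjoint from the flow `T`: for every continuous `f : X → ℂ` and every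
`x ∈ X`, `(1/N) ∑_{n=1}^N c n · f(Tⁿ x) → 0` as `N → ∞`. -/
def LinearlyDisjoint {X : Type*} [TopologicalSpace X] (c : ℕ → ℂ) (T : X → X) : Prop :=
  ∀ f : X → ℂ, Continuous f → ∀ x : X,
    Tendsto (fun N : ℕ => (1 / N : ℂ) * ∑ n ∈ Finset.Icc 1 N, c n * f (T^[n] x)) atTop (nhds 0)

section Tauber
open MeasureTheory SchwartzMap FourierTransform Topology

theorem tb_core (φ : ℝ → ℂ) (hm : Measurable φ) (hb : ∀ t, ‖φ t‖ ≤ 1)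
    (G : ℝ × ℝ → ℂ) (hG : Continuous G)
    (hGe : ∀ σ v : ℝ, 0 < σ → G (σ, v) =
      ∫ t in Set.Ioi (0:ℝ), φ t * Complex.exp (-(σ + v * Complex.I) * t))
    (k : 𝓢(ℝ, ℂ)) (hk : HasCompactSupport k) :
    Tendsto (fun T : ℝ => ∫ t in Set.Ioi (0:ℝ), φ t * (𝓕 k) (t - T)) atTop (𝓝 0) := by
  have key : ∀ T : ℝ, ∀ σ : ℝ, 0 < σ →
      ∫ t in Set.Ioi (0:ℝ), Complex.exp (-(σ:ℂ) * t) * (φ t * (𝓕 k) (t - T)) =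
      ∫ v : ℝ, Complex.exp ((2 * Real.pi * v * T : ℝ) * Complex.I) * (k v * G (σ, 2 * Real.pi * v)) := by
    intro T σ hσ
    have h1 : ∀ t : ℝ, Complex.exp (-(σ:ℂ) * t) * (φ t * (𝓕 k) (t - T)) =
        ∫ v : ℝ, (Complex.exp (-(σ:ℂ) * t) * φ t) *
          (Complex.exp ((-2 * Real.pi * v * (t - T) : ℝ) * Complex.I) * k v) := by
      intro t
      rw [integral_const_mul, SchwartzMap.fourier_coe, Real.fourier_real_eq_integral_exp_smul]
      simp only [smul_eq_mul]
      ring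
    simp_rw [h1]
    rw [integral_integral_swap]
    · congr 1
      ext v
      rw [hGe _ _ hσ, ← integral_const_mul, ← integral_const_mul]
      congr 1
      ext t
      have : Complex.exp (-(σ:ℂ) * t) * Complex.exp ((-2 * Real.pi * v * (t - T) : ℝ) * Complex.I)
        = Complex.exp ((2 * Real.pi * v * T : ℝ) * Complex.I) *
          Complex.exp (-(σ + (2 * Real.pi * v : ℝ) * Complex.I) * t) := by
        rw [← Complex.exp_add, ← Complex.exp_add]
        congr 1
        push_cast
        ring
      linear_combination (φ t * k v) * this
    · have hi : Integrable (fun z : ℝ × ℝ => ((Real.exp (-σ * z.1) : ℝ)) * ‖k z.2‖)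
          ((volume.restrict (Set.Ioi 0)).prod volume) :=
        Integrable.mul_prod (integrableOn_exp_mul_Ioi (by linarith) 0) k.integrable.norm
      refine hi.mono' ?_ ?_
      · apply Measurable.aestronglyMeasurable
        have := k.continuous.measurable
        unfold Function.uncurry
        fun_prop
      · refine Eventually.of_forall fun z => ?_
        simp only [Function.uncurry, norm_mul, Complex.norm_exp_ofReal_mul_I, one_mul]
        have : ‖Complex.exp (-(σ:ℂ) * z.1)‖ = Real.exp (-σ * z.1) := by
          rw [Complex.norm_exp]; simp
        rw [this]
        have := hb z.1
        have h2 := Real.exp_pos (-σ * z.1)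
        gcongr
        nlinarith
  have key2 : ∀ T : ℝ, ∫ t in Set.Ioi (0:ℝ), (φ t * (𝓕 k) (t - T)) =
      ∫ v : ℝ, Complex.exp ((2 * Real.pi * v * T : ℝ) * Complex.I) * (k v * G (0, 2 * Real.pi * v)) := by
    intro T
    have hFk : Integrable (fun t : ℝ => ‖(𝓕 k) (t - T)‖) :=
      ((𝓕 k).integrable (μ := volume)).norm.comp_sub_right T
    have l1 : Tendsto (fun σ : ℝ => ∫ t in Set.Ioi (0:ℝ), Complex.exp (-(σ:ℂ) * t) * (φ t * (𝓕 k) (t - T)))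
        (𝓝[>] 0) (𝓝 (∫ t in Set.Ioi (0:ℝ), (φ t * (𝓕 k) (t - T)))) := by
      apply tendsto_integral_filter_of_dominated_convergence (fun t => ‖(𝓕 k) (t - T)‖)
      · refine Eventually.of_forall fun σ => ?_
        apply Measurable.aestronglyMeasurable
        have := (𝓕 k).continuous.measurable
        fun_prop
      · filter_upwards [self_mem_nhdsWithin] with σ hσ
        filter_upwards [ae_restrict_mem measurableSet_Ioi] with t ht
        simp only [Set.mem_Ioi] at hσ ht
        rw [norm_mul, norm_mul, Complex.norm_exp]
        have : Real.exp (-(σ:ℂ) * t).re ≤ 1 := by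
          rw [Real.exp_le_one_iff]; simp; positivity
        have h3 := hb t
        calc _ ≤ 1 * (1 * ‖(𝓕 k) (t - T)‖) := by gcongr
          _ = _ := by ring
      · exact hFk.integrableOn
      · refine Eventually.of_forall fun t => ?_
        have : Continuous fun σ : ℝ => Complex.exp (-(σ:ℂ) * t) * (φ t * (𝓕 k) (t - T)) := by fun_prop
        have := this.tendsto 0
        simp only [Complex.ofReal_zero, neg_zero, zero_mul, Complex.exp_zero, one_mul] at this
        exact this.mono_left nhdsWithin_le_nhds
    have hK : IsCompact (Set.Icc (0:ℝ) 1 ×ˢ tsupport k) := isCompact_Icc.prod hk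
    obtain ⟨C, hC⟩ := hK.exists_bound_of_continuousOn
      (f := fun z : ℝ × ℝ => G (z.1, 2 * Real.pi * z.2)) (by fun_prop)
    have l2 : Tendsto (fun σ : ℝ => ∫ v : ℝ, Complex.exp ((2 * Real.pi * v * T : ℝ) * Complex.I) * (k v * G (σ, 2 * Real.pi * v)))
        (𝓝[>] 0) (𝓝 (∫ v : ℝ, Complex.exp ((2 * Real.pi * v * T : ℝ) * Complex.I) * (k v * G (0, 2 * Real.pi * v)))) := by
      apply tendsto_integral_filter_of_dominated_convergence (fun v => ‖k v‖ * C)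
      · refine Eventually.of_forall fun σ => ?_
        apply Continuous.aestronglyMeasurable
        have := k.continuous
        fun_prop
      · have : Set.Ioc (0:ℝ) 1 ∈ 𝓝[>] (0:ℝ) := Ioc_mem_nhdsGT (by norm_num)
        filter_upwards [this] with σ hσ
        refine Eventually.of_forall fun v => ?_
        rw [norm_mul, norm_mul, Complex.norm_exp_ofReal_mul_I, one_mul]
        by_cases hv : v ∈ tsupport k
        · have := hC (σ, v) ⟨⟨hσ.1.le, hσ.2⟩, hv⟩
          gcongr
        · simp [image_eq_zero_of_notMem_tsupport hv]
      · exact k.integrable.norm.mul_const C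
      · refine Eventually.of_forall fun v => ?_
        have : Continuous fun σ : ℝ => Complex.exp ((2 * Real.pi * v * T : ℝ) * Complex.I) * (k v * G (σ, 2 * Real.pi * v)) := by fun_prop
        exact (this.tendsto 0).mono_left nhdsWithin_le_nhds
    refine tendsto_nhds_unique (l1.congr' ?_) l2
    filter_upwards [self_mem_nhdsWithin] with σ hσ
    exact key T σ hσ
  simp_rw [key2]
  have rl := Real.tendsto_integral_exp_smul_cocompact (fun v : ℝ => k v * G (0, 2 * Real.pi * v))
  have h2 : Tendsto (fun T : ℝ => -T) atTop (cocompact ℝ) := by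
    rw [cocompact_eq_atBot_atTop]
    exact tendsto_neg_atTop_atBot.mono_right le_sup_left
  refine (rl.comp h2).congr fun T => ?_
  simp only [Function.comp]
  congr 1
  ext v
  rw [Circle.smul_def, Real.fourierChar_apply, smul_eq_mul]
  congr 2
  push_cast
  ring

theorem tb_kernel : ∃ k : 𝓢(ℝ, ℂ), HasCompactSupport k ∧ ∫ u : ℝ, (𝓕 k) u = 1 := by
  let f : ContDiffBump (0:ℝ) := default
  let g : ℝ → ℂ := fun x => (f x : ℂ)
  have hg : HasCompactSupport g := f.hasCompactSupport.comp_left (g := fun x : ℝ => (x:ℂ)) (by simp)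
  have hg2 : ContDiff ℝ (⊤ : ℕ∞) g := Complex.ofRealCLM.contDiff.comp f.contDiff
  refine ⟨hg.toSchwartzMap hg2, hg, ?_⟩
  set k := hg.toSchwartzMap hg2 with hkdef
  have h1 : (𝓕⁻ (𝓕 k)) 0 = k 0 := by
    rw [FourierTransform.fourierInv_fourier_eq]
  rw [SchwartzMap.fourierInv_coe, Real.fourierInv_eq'] at h1
  simp only [inner_zero_right, mul_zero, Complex.ofReal_zero, zero_mul, Complex.exp_zero, one_smul] at h1
  rw [h1]
  change ((f 0 : ℝ) : ℂ) = 1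
  rw [f.one_of_mem_closedBall (by simp [f.rIn_pos.le])]
  simp

theorem tauber (φ : ℝ → ℂ) (hm : Measurable φ) (hb : ∀ t, ‖φ t‖ ≤ 1) (h0 : ∀ t < 0, φ t = 0)
    (hL : ∀ t s, ‖φ t - φ s‖ ≤ 2 * |t - s| + Real.exp (-t))
    (G : ℝ × ℝ → ℂ) (hG : Continuous G)
    (hGe : ∀ σ v : ℝ, 0 < σ → G (σ, v) =
      ∫ t in Set.Ioi (0:ℝ), φ t * Complex.exp (-(σ + v * Complex.I) * t)) :
    Tendsto φ atTop (𝓝 0) := by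
  obtain ⟨k, hk, hk1⟩ := tb_kernel
  set K := 𝓕 k with hKdef
  have hKi : Integrable K := K.integrable
  set C0 := ∫ u, ‖K u‖
  set C1 := ∫ u, |u| * ‖K u‖
  have hC1i : Integrable (fun u => |u| * ‖K u‖) := by simpa using K.integrable_pow_mul volume 1
  have hC0 : 0 ≤ C0 := integral_nonneg fun u => norm_nonneg _
  have hC1 : 0 ≤ C1 := integral_nonneg fun u => by positivity
  have main : ∀ lam : ℝ, 0 < lam → Tendsto (fun T : ℝ => ∫ u, φ (T + u / lam) * K u) atTop (𝓝 0) := by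
    intro lam hl
    have hc := tb_core (fun t => φ (t / lam)) (by fun_prop) (fun t => hb _)
      (fun z => lam * G (lam * z.1, lam * z.2)) (by fun_prop) ?_ k hk
    · have h2 : Tendsto (fun T : ℝ => lam * T) atTop atTop := tendsto_id.const_mul_atTop hl
      refine (hc.comp h2).congr fun T => ?_
      simp only [Function.comp]
      rw [← integral_Ici_eq_integral_Ioi, setIntegral_eq_integral_of_forall_compl_eq_zero]
      · rw [← integral_add_right_eq_self _ (lam * T)]
        congr 1
        ext u
        congr 2
        · field_simp; ring
        · ring
      · intro x hx
        simp only [Set.mem_Ici, not_le] at hx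
        rw [h0 _ (div_neg_of_neg_of_pos hx hl), zero_mul]
    · intro σ v hσ
      simp only
      rw [hGe _ _ (by positivity)]
      have := integral_comp_mul_left_Ioi (fun t : ℝ => φ (t / lam) * Complex.exp (-(σ + v * Complex.I) * t)) 0 hl
      rw [mul_zero] at this
      have h3 : ∀ I : ℂ, lam * (lam⁻¹ • I) = I := by
        intro I
        rw [Complex.real_smul]; push_cast
        have : (lam : ℂ) ≠ 0 := by exact_mod_cast hl.ne'
        field_simp
      rw [← h3 (∫ t in Set.Ioi (0:ℝ), φ (t / lam) * Complex.exp (-(σ + v * Complex.I) * t)), ← this]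
      congr 2
      ext t
      rw [mul_div_cancel_left₀ _ hl.ne']
      congr 2
      push_cast
      ring
  have bound : ∀ lam : ℝ, 0 < lam → ∀ T : ℝ, ‖φ T - ∫ u, φ (T + u / lam) * K u‖ ≤
      2 / lam * C1 + Real.exp (-T) * C0 := by
    intro lam hl T
    have hi : Integrable (fun u => φ (T + u / lam) * K u) := by
      refine hKi.norm.mono' ?_ ?_
      · apply Measurable.aestronglyMeasurable
        have := K.continuous.measurable
        fun_prop
      · refine Eventually.of_forall fun u => ?_
        rw [norm_mul]
        have := hb (T + u / lam)
        nlinarith [norm_nonneg (K u)]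
    have : φ T - ∫ u, φ (T + u / lam) * K u = ∫ u, (φ T - φ (T + u / lam)) * K u := by
      simp_rw [sub_mul]
      rw [integral_sub (hKi.const_mul _) hi, integral_const_mul, hk1, mul_one]
    rw [this]
    have hbi : Integrable (fun u => 2 / lam * (|u| * ‖K u‖) + Real.exp (-T) * ‖K u‖) :=
      (hC1i.const_mul _).add (hKi.norm.const_mul _)
    refine (norm_integral_le_of_norm_le hbi (Eventually.of_forall fun u => ?_)).trans_eq ?_
    · rw [norm_mul]
      have := hL T (T + u / lam)
      have h4 : |T - (T + u / lam)| = |u| / lam := by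
        rw [sub_add_cancel_left, abs_neg, abs_div, abs_of_pos hl]
      rw [h4] at this
      calc _ ≤ (2 * (|u| / lam) + Real.exp (-T)) * ‖K u‖ := by gcongr
        _ = _ := by ring
    · rw [integral_add (hC1i.const_mul _) (hKi.norm.const_mul _), integral_const_mul, integral_const_mul]
  rw [Metric.tendsto_atTop]
  intro ε hε
  obtain ⟨lam, hl, hl2⟩ : ∃ lam : ℝ, 0 < lam ∧ 2 / lam * C1 < ε / 3 := by
    refine ⟨6 * (C1 + 1) / ε + 1, by positivity, ?_⟩
    rw [div_mul_eq_mul_div, div_lt_iff₀ (by positivity)]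
    have : ε / 3 * (6 * (C1 + 1) / ε + 1) = 2 * (C1 + 1) + ε / 3 := by field_simp; ring
    rw [this]; linarith
  have e1 : Tendsto (fun T : ℝ => Real.exp (-T) * C0) atTop (𝓝 0) := by
    simpa using (Real.tendsto_exp_neg_atTop_nhds_zero).mul_const C0
  have e2 := (main lam hl).norm
  rw [norm_zero] at e2
  obtain ⟨T0, hT0⟩ := eventually_atTop.1 ((e1.eventually_lt_const (by positivity : 0 < ε / 3)).and
    (e2.eventually_lt_const (by positivity : 0 < ε / 3)))
  refine ⟨T0, fun T hT => ?_⟩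
  obtain ⟨a1, a2⟩ := hT0 T hT
  rw [dist_zero_right]
  have b := bound lam hl T
  have := norm_le_norm_sub_add (φ T) (∫ u, φ (T + u / lam) * K u)
  linarith

end Tauber

section PNT
open MeasureTheory Topology

theorem sumIcc_sub_le (c : ℕ → ℂ) (hc : ∀ n, ‖c n‖ ≤ 1) {a b : ℕ} (hab : a ≤ b) :
    ‖∑ n ∈ Finset.Icc 1 b, c n - ∑ n ∈ Finset.Icc 1 a, c n‖ ≤ (b:ℝ) - a := by
  have hs : Finset.Icc 1 a ⊆ Finset.Icc 1 b := Finset.Icc_subset_Icc_right hab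
  rw [← Finset.sum_sdiff hs, add_sub_cancel_right]
  refine (norm_sum_le_of_le _ (fun n _ => hc n)).trans ?_
  rw [Finset.sum_const, Finset.card_sdiff_of_subset hs]
  simp only [Nat.card_Icc, nsmul_eq_mul, mul_one, Nat.add_sub_cancel]
  rw [Nat.cast_sub hab]

theorem sumIcc_le (c : ℕ → ℂ) (hc : ∀ n, ‖c n‖ ≤ 1) (b : ℕ) :
    ‖∑ n ∈ Finset.Icc 1 b, c n‖ ≤ (b:ℝ) := by
  simpa using sumIcc_sub_le c hc (Nat.zero_le b)

theorem tauber_series (c : ℕ → ℂ) (hc : ∀ n, ‖c n‖ ≤ 1) (H : ℂ → ℂ)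
    (hH : ContinuousOn H {s | 1 ≤ s.re}) (hHe : ∀ s : ℂ, 1 < s.re → LSeries c s = H s) :
    Tendsto (fun N : ℕ => (1 / N : ℂ) * ∑ n ∈ Finset.Icc 1 N, c n) atTop (𝓝 0) := by
  set S : ℝ → ℂ := fun x => ∑ n ∈ Finset.Icc 1 ⌊x⌋₊, c n with hS
  set φ : ℝ → ℂ := fun t => S (Real.exp t) * Complex.exp (-t) with hφ
  have hSb : ∀ x, 0 ≤ x → ‖S x‖ ≤ x := fun x hx =>
    (sumIcc_le c hc _).trans (Nat.floor_le hx)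
  have hne : ∀ t : ℝ, ‖Complex.exp (-(t:ℂ))‖ = Real.exp (-t) := by
    intro t; rw [Complex.norm_exp]; simp
  have hSm : Measurable S := by
    have : Measurable (fun k : ℕ => ∑ n ∈ Finset.Icc 1 k, c n) := measurable_from_nat
    exact this.comp Nat.measurable_floor
  have hL1 : ∀ s t : ℝ, s ≤ t → ‖φ t - φ s‖ ≤ 2 * (t - s) + Real.exp (-t) := by
    intro s t hst
    have e : φ t - φ s = (S (Real.exp t) - S (Real.exp s)) * Complex.exp (-t)
        + S (Real.exp s) * (Complex.exp (-t) - Complex.exp (-s)) := by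
      simp only [hφ]; ring
    have h1 : ‖S (Real.exp t) - S (Real.exp s)‖ ≤ Real.exp t - Real.exp s + 1 := by
      have hle : ⌊Real.exp s⌋₊ ≤ ⌊Real.exp t⌋₊ := Nat.floor_mono (Real.exp_le_exp.2 hst)
      refine (sumIcc_sub_le c hc hle).trans ?_
      have := Nat.floor_le (Real.exp_pos t).le
      have := Nat.lt_floor_add_one (Real.exp s)
      linarith
    have h2 : ‖Complex.exp (-(t:ℂ)) - Complex.exp (-(s:ℂ))‖ = Real.exp (-s) - Real.exp (-t) := by
      have : Complex.exp (-(t:ℂ)) - Complex.exp (-(s:ℂ)) = ((Real.exp (-t) - Real.exp (-s) : ℝ) : ℂ) := by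
        push_cast; rfl
      rw [this, Complex.norm_real, Real.norm_eq_abs, abs_sub_comm, abs_of_nonneg]
      have := Real.exp_le_exp.2 (neg_le_neg hst)
      linarith
    rw [e]
    refine (norm_add_le _ _).trans ?_
    rw [norm_mul, norm_mul, h2, hne]
    have h3 := hSb _ (Real.exp_pos s).le
    have p1 : Real.exp t * Real.exp (-t) = 1 := by rw [← Real.exp_add]; simp
    have p2 : Real.exp s * Real.exp (-s) = 1 := by rw [← Real.exp_add]; simp
    have p3 : Real.exp s * Real.exp (-t) = Real.exp (-(t - s)) := by rw [← Real.exp_add]; congr 1; ring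
    have p4 : 1 - (t - s) ≤ Real.exp (-(t - s)) := by
      have := Real.add_one_le_exp (-(t-s)); linarith
    have p5 : Real.exp (-t) ≤ Real.exp (-s) := Real.exp_le_exp.2 (neg_le_neg hst)
    calc _ ≤ (Real.exp t - Real.exp s + 1) * Real.exp (-t) + Real.exp s * (Real.exp (-s) - Real.exp (-t)) := by
          gcongr
      _ = 2 * (1 - Real.exp (-(t-s))) + Real.exp (-t) := by
          rw [← p3]; linear_combination p1 + p2
      _ ≤ _ := by linarith
  have hlim : Tendsto φ atTop (𝓝 0) := by
    apply tauber φ _ _ _ _ (fun z => H (1 + (max z.1 0 : ℝ) + z.2 * Complex.I) / (1 + (max z.1 0 : ℝ) + z.2 * Complex.I))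
    · have hc1 : Continuous (fun z : ℝ × ℝ => (1 + (max z.1 0 : ℝ) + z.2 * Complex.I : ℂ)) := by fun_prop
      apply Continuous.div
      · apply hH.comp_continuous hc1
        intro z
        simp
      · exact hc1
      · intro z h
        have := congrArg Complex.re h
        simp at this
        have h5 := le_max_right z.1 0
        linarith
    · intro σ v hσ
      set s : ℂ := 1 + σ + v * Complex.I with hs
      have hsre : 1 < s.re := by simp [hs, hσ]
      have hs0 : s ≠ 0 := by intro h; rw [h] at hsre; simp at hsre; linarith
      have hO : (fun n : ℕ => ∑ k ∈ Finset.Icc 1 n, ‖c k‖) =O[atTop] fun n => (n:ℝ) ^ (1:ℝ) := by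
        apply Asymptotics.IsBigO.of_bound 1
        refine Eventually.of_forall fun n => ?_
        rw [Real.norm_of_nonneg (by positivity)]
        simp only [Real.rpow_one, one_mul, RCLike.norm_natCast]
        refine (Finset.sum_le_sum fun n _ => hc n).trans ?_
        simp
      have h1 := LSeries_eq_mul_integral' c zero_le_one hsre hO
      rw [hHe s hsre] at h1
      simp only [max_eq_left hσ.le]
      rw [← hs, h1, mul_div_cancel_left₀ _ hs0]
      have him : Real.exp '' Set.Ioi 0 = Set.Ioi 1 := by
        ext y
        constructor
        · rintro ⟨x, hx, rfl⟩
          exact Real.one_lt_exp_iff.2 hx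
        · intro hy
          have : (0:ℝ) < y := lt_trans one_pos hy
          exact ⟨Real.log y, Real.log_pos hy, Real.exp_log this⟩
      rw [← him, integral_image_eq_integral_abs_deriv_smul measurableSet_Ioi
        (fun x _ => (Real.hasDerivAt_exp x).hasDerivWithinAt) Real.exp_injective.injOn]
      congr 1
      ext t
      rw [abs_of_pos (Real.exp_pos t), Complex.real_smul]
      simp only [hφ, hS]
      rw [Complex.cpow_def_of_ne_zero (by exact_mod_cast (Real.exp_pos t).ne'), ← Complex.ofReal_log (Real.exp_pos t).le,
        Real.log_exp, Complex.ofReal_exp]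
      have : Complex.exp t * Complex.exp (t * -(s+1)) = Complex.exp (-t) * Complex.exp (-(σ + v * Complex.I) * t) := by
        rw [← Complex.exp_add, ← Complex.exp_add]
        congr 1
        rw [hs]; ring
      linear_combination (∑ k ∈ Finset.Icc 1 ⌊Real.exp t⌋₊, c k) * this
    · simp only [hφ]
      fun_prop
    · intro t
      simp only [hφ]
      rw [norm_mul, hne]
      have := hSb _ (Real.exp_pos t).le
      calc _ ≤ Real.exp t * Real.exp (-t) := by gcongr
        _ = 1 := by rw [← Real.exp_add]; simp
    · intro t ht
      have : ⌊Real.exp t⌋₊ = 0 := by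
        rw [Nat.floor_eq_zero]; simpa using Real.exp_lt_exp.2 ht
      simp [hφ, hS, this]
    · intro t s
      rcases le_total s t with h | h
      · rw [abs_of_nonneg (by linarith)]; exact hL1 s t h
      · rw [norm_sub_rev, abs_sub_comm, abs_of_nonneg (by linarith)]
        refine (hL1 t s h).trans ?_
        have := Real.exp_le_exp.2 (neg_le_neg h)
        linarith
  have hlog : Tendsto (fun N : ℕ => Real.log N) atTop atTop :=
    Real.tendsto_log_atTop.comp tendsto_natCast_atTop_atTop
  refine (hlim.comp hlog).congr' ?_
  filter_upwards [eventually_gt_atTop 0] with N hN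
  have hN' : (0:ℝ) < N := by exact_mod_cast hN
  simp only [Function.comp, hφ, hS]
  rw [Real.exp_log hN', Nat.floor_natCast, Complex.exp_neg, ← Complex.ofReal_exp, Real.exp_log hN']
  simp
  ring

def mavg (F : ℕ → ℂ) : Prop :=
  Tendsto (fun N : ℕ => (1 / N : ℂ) * ∑ n ∈ Finset.Icc 1 N,
    (ArithmeticFunction.moebius n : ℂ) * F n) atTop (𝓝 0)

theorem moebius_norm_le (n : ℕ) : ‖(ArithmeticFunction.moebius n : ℂ)‖ ≤ 1 := by
  rw [Complex.norm_intCast]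
  exact_mod_cast ArithmeticFunction.abs_moebius_le_one

theorem mavg_char {D : ℕ} [NeZero D] (χ : DirichletCharacter ℂ D) : mavg (fun n => χ n) := by
  obtain ⟨H, hH, hHe⟩ : ∃ H : ℂ → ℂ, ContinuousOn H {s | 1 ≤ s.re} ∧
      ∀ s : ℂ, 1 < s.re → (DirichletCharacter.LFunction χ s)⁻¹ = H s := by
    by_cases hχ : χ = 1
    · refine ⟨fun s => (s - 1) / DirichletCharacter.LFunctionTrivChar₁ D s, ?_, ?_⟩
      · apply ContinuousOn.div (by fun_prop)
        · exact (DirichletCharacter.differentiable_LFunctionTrivChar₁ D).continuous.continuousOn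
        · intro s hs
          by_cases h1 : s = 1
          · rw [h1]; exact DirichletCharacter.LFunctionTrivChar₁_apply_one_ne_zero D
          · unfold DirichletCharacter.LFunctionTrivChar₁
            rw [Function.update_of_ne h1]
            exact mul_ne_zero (sub_ne_zero.2 h1)
              (DirichletCharacter.LFunction_ne_zero_of_one_le_re 1 (Or.inr h1) hs)
      · intro s hs
        have h1 : s ≠ 1 := by rintro rfl; simp at hs
        simp only
        unfold DirichletCharacter.LFunctionTrivChar₁
        rw [Function.update_of_ne h1, hχ]
        have := sub_ne_zero.2 h1
        unfold DirichletCharacter.LFunctionTrivChar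
        field_simp
    · refine ⟨fun s => (DirichletCharacter.LFunction χ s)⁻¹, ?_, fun s _ => rfl⟩
      apply ContinuousOn.inv₀
      · exact (DirichletCharacter.differentiable_LFunction hχ).continuous.continuousOn
      · intro s hs
        exact DirichletCharacter.LFunction_ne_zero_of_one_le_re χ (Or.inl hχ) hs
  have := tauber_series (fun n => (ArithmeticFunction.moebius n : ℂ) * χ n) ?_ H hH ?_
  · exact this
  · intro n
    rw [norm_mul]
    have h1 := moebius_norm_le n
    have h2 := χ.norm_le_one n
    nlinarith [norm_nonneg (χ (n : ZMod D))]
  · intro s hs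
    rw [← hHe s hs, DirichletCharacter.LFunction_eq_LSeries χ hs]
    have := DirichletCharacter.LSeries.mul_mu_eq_one χ hs
    apply eq_inv_of_mul_eq_one_right
    rw [← this]
    congr 2
    ext n
    simp [mul_comm]

end PNT

section Periodic
open Topology

theorem avg_div (S : ℕ → ℂ) (h : Tendsto (fun N : ℕ => (1 / N : ℂ) * S N) atTop (𝓝 0)) (g : ℕ)
    (hg : 0 < g) : Tendsto (fun N : ℕ => (1 / N : ℂ) * S (N / g)) atTop (𝓝 0) := by
  have h1 : Tendsto (fun N : ℕ => N / g) atTop atTop := Nat.tendsto_div_const_atTop hg.ne'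
  have h2 := (h.comp h1).norm
  rw [norm_zero] at h2
  rw [tendsto_zero_iff_norm_tendsto_zero]
  refine tendsto_of_tendsto_of_tendsto_of_le_of_le' tendsto_const_nhds h2
    (Eventually.of_forall fun _ => norm_nonneg _) ?_
  filter_upwards [eventually_ge_atTop g] with N hN
  simp only [Function.comp, norm_mul]
  gcongr
  simp only [one_div, norm_inv, RCLike.norm_natCast]
  have : 0 < N / g := Nat.div_pos hN hg
  gcongr
  exact Nat.div_le_self N g

theorem mavg_sum {ι : Type*} (s : Finset ι) (c : ι → ℂ) (F : ι → ℕ → ℂ) (h : ∀ i ∈ s, mavg (F i)) :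
    mavg (fun n => ∑ i ∈ s, c i * F i n) := by
  have := tendsto_finsetSum s (fun i hi => (h i hi).const_mul (c i))
  simp only [mul_zero, Finset.sum_const_zero] at this
  refine this.congr fun N => ?_
  simp_rw [Finset.mul_sum]
  rw [Finset.sum_comm]
  congr 1; ext n; congr 1; ext i
  ring

theorem mavg_units {D : ℕ} [NeZero D] (h : ZMod D → ℂ) (hh : ∀ b, ¬ IsUnit b → h b = 0) :
    mavg (fun n => h n) := by
  have e : (fun n : ℕ => h n) = fun n : ℕ => ∑ χ : DirichletCharacter ℂ D,
      (∑ b : ZMod D, h b * χ b⁻¹ / D.totient) * χ n := by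
    ext n
    simp_rw [Finset.sum_mul]
    rw [Finset.sum_comm]
    have : ∀ b : ZMod D, ∑ χ : DirichletCharacter ℂ D, h b * χ b⁻¹ / D.totient * χ n =
        if b = n then h b else 0 := by
      intro b
      by_cases hb : IsUnit b
      · have := DirichletCharacter.sum_char_inv_mul_char_eq ℂ hb (n : ZMod D)
        have h3 : (D.totient : ℂ) ≠ 0 := by
          exact_mod_cast (Nat.totient_pos.2 (Nat.pos_of_neZero D)).ne'
        calc _ = h b / D.totient * ∑ χ : DirichletCharacter ℂ D, χ b⁻¹ * χ n := by
              rw [Finset.mul_sum]; congr 1; ext χ; ring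
          _ = _ := by
              rw [this]; split_ifs
              · field_simp
              · simp
      · simp [hh b hb]
    simp_rw [this]
    simp
  rw [e]
  exact mavg_sum _ _ _ (fun χ _ => mavg_char χ)

theorem mavg_class {D : ℕ} [NeZero D] (a : ZMod D) :
    mavg (fun n => if (n : ZMod D) = a then 1 else 0) := by
  set r := a.val with hr
  have hra : ((r : ℕ) : ZMod D) = a := by simp [hr]
  set g := Nat.gcd r D with hg
  have hD : 0 < D := Nat.pos_of_neZero D
  have hgD : g ∣ D := Nat.gcd_dvd_right _ _
  have hgr : g ∣ r := Nat.gcd_dvd_left _ _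
  have hg0 : 0 < g := Nat.gcd_pos_of_pos_right _ hD
  have hcast : ∀ n : ℕ, (n : ZMod D) = a ↔ n ≡ r [MOD D] := by
    intro n; rw [← hra, ZMod.natCast_eq_natCast_iff]
  have hgcd : ∀ m : ℕ, Nat.Coprime (m : ZMod D).val g ↔ Nat.Coprime m g := by
    intro m
    rw [ZMod.val_natCast]
    unfold Nat.Coprime
    have : Nat.gcd (m % D) g = Nat.gcd m g := by
      rw [Nat.gcd_comm, Nat.gcd_rec, Nat.mod_mod_of_dvd _ hgD, ← Nat.gcd_rec, Nat.gcd_comm]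
    rw [this]
  classical
  set h : ZMod D → ℂ := fun b => if (g : ZMod D) * b = a ∧ Nat.Coprime b.val g then 1 else 0 with hh
  have hu : mavg (fun m => h m) := by
    apply mavg_units
    intro b hb
    simp only [hh]
    rw [if_neg]
    rintro ⟨h1, h2⟩
    apply hb
    have hbv : ((b.val : ℕ) : ZMod D) = b := by simp
    rw [← hbv, ZMod.isUnit_iff_coprime]
    rw [← hbv, ← Nat.cast_mul, hcast] at h1
    by_contra hc
    obtain ⟨p, hp, hp1, hp2⟩ := Nat.Prime.not_coprime_iff_dvd.1 hc
    have hpr : p ∣ r := by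
      have := (h1.of_dvd hp2)
      exact (this.dvd_iff dvd_rfl).1 (dvd_mul_of_dvd_right hp1 g)
    have hpg : p ∣ g := Nat.dvd_gcd hpr hp2
    exact Nat.Prime.not_coprime_iff_dvd.2 ⟨p, hp, hp1, hpg⟩ h2
  have h2 := (avg_div _ hu g hg0).const_mul (ArithmeticFunction.moebius g : ℂ)
  rw [mul_zero] at h2
  refine h2.congr fun N => ?_
  rw [mul_left_comm]
  congr 1
  rw [Finset.mul_sum]
  have hinj : Set.InjOn (fun m => g * m) (Finset.Icc 1 (N / g) : Set ℕ) := by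
    intro x _ y _ hxy
    exact Nat.eq_of_mul_eq_mul_left hg0 hxy
  have himg : (Finset.Icc 1 (N / g)).image (fun m => g * m) ⊆ Finset.Icc 1 N := by
    intro n hn
    obtain ⟨m, hm, rfl⟩ := Finset.mem_image.1 hn
    rw [Finset.mem_Icc] at hm ⊢
    refine ⟨Nat.mul_pos hg0 hm.1, ?_⟩
    rw [mul_comm]
    exact (Nat.le_div_iff_mul_le hg0).1 hm.2
  rw [← Finset.sum_subset himg, Finset.sum_image hinj]
  · apply Finset.sum_congr rfl
    intro m hm
    simp only [hh, hgcd, Nat.cast_mul]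
    by_cases hc : Nat.Coprime m g
    · rw [ArithmeticFunction.isMultiplicative_moebius.map_mul_of_coprime hc.symm]
      simp only [and_iff_left hc]
      push_cast
      split_ifs <;> simp
    · have : ArithmeticFunction.moebius (g * m) = 0 := by
        apply ArithmeticFunction.moebius_eq_zero_of_not_squarefree
        intro hsq
        exact hc (Nat.coprime_of_squarefree_mul hsq).symm
      simp [hc, this]
  · intro n hn hn2
    simp only
    rw [if_neg, mul_zero]
    intro h3
    apply hn2
    rw [hcast] at h3
    have hgn : g ∣ n := ((h3.of_dvd hgD).dvd_iff dvd_rfl).2 hgr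
    obtain ⟨m, rfl⟩ := hgn
    rw [Finset.mem_Icc] at hn
    refine Finset.mem_image.2 ⟨m, ?_, rfl⟩
    rw [Finset.mem_Icc]
    refine ⟨Nat.pos_of_ne_zero (by rintro rfl; simp at hn), ?_⟩
    rw [Nat.le_div_iff_mul_le hg0, mul_comm]; exact hn.2

theorem mavg_zmod {D : ℕ} [NeZero D] (F : ZMod D → ℂ) : mavg (fun n => F n) := by
  have := mavg_sum Finset.univ F (fun (b : ZMod D) (n : ℕ) => if (n : ZMod D) = b then (1:ℂ) else 0)
    (fun b _ => mavg_class b)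
  simpa using this

end Periodic

section Katai
open Topology

theorem sum_dvd_eq {M : Type*} [AddCommMonoid M] (p N : ℕ) (hp : 0 < p) (f : ℕ → M) :
    ∑ n ∈ Finset.Icc 1 N, (if p ∣ n then f n else 0) = ∑ m ∈ Finset.Icc 1 (N / p), f (p * m) := by
  rw [← Finset.sum_filter]
  symm
  apply Finset.sum_bij (fun m _ => p * m)
  · intro m hm
    rw [Finset.mem_Icc] at hm
    rw [Finset.mem_filter, Finset.mem_Icc]
    refine ⟨⟨Nat.mul_pos hp hm.1, ?_⟩, dvd_mul_right _ _⟩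
    rw [mul_comm]; exact (Nat.le_div_iff_mul_le hp).1 hm.2
  · intro x _ y _ h
    exact Nat.eq_of_mul_eq_mul_left hp h
  · intro n hn
    rw [Finset.mem_filter, Finset.mem_Icc] at hn
    obtain ⟨⟨h1, h2⟩, m, rfl⟩ := hn
    refine ⟨m, ?_, rfl⟩
    rw [Finset.mem_Icc]
    refine ⟨Nat.pos_of_ne_zero (by rintro rfl; simp at h1), ?_⟩
    rw [Nat.le_div_iff_mul_le hp, mul_comm]; exact h2
  · intros; rfl

theorem sum_trunc {M : Type*} [AddCommMonoid M] (k N : ℕ) (hk : k ≤ N) (f : ℕ → M) :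
    ∑ m ∈ Finset.Icc 1 N, (if m ≤ k then f m else 0) = ∑ m ∈ Finset.Icc 1 k, f m := by
  rw [← Finset.sum_filter]
  congr 1
  ext m
  simp only [Finset.mem_filter, Finset.mem_Icc]
  omega

theorem count_dvd (p N : ℕ) (hp : 0 < p) :
    ∑ n ∈ Finset.Icc 1 N, (if p ∣ n then (1:ℝ) else 0) = ((N / p : ℕ) : ℝ) := by
  rw [sum_dvd_eq p N hp]; simp

theorem turan_kubilius (P : Finset ℕ) (hP : ∀ p ∈ P, p.Prime) (N : ℕ) (L : ℝ)
    (hL : L = ∑ p ∈ P, (1 / p : ℝ)) :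
    ∑ n ∈ Finset.Icc 1 N, ((∑ p ∈ P, (if p ∣ n then (1:ℝ) else 0)) - L) ^ 2 ≤
      N * L + 2 * L * P.card := by
  have hL0 : 0 ≤ L := by rw [hL]; exact Finset.sum_nonneg fun p _ => by positivity
  have h1 : (N:ℝ) * L - P.card ≤ ∑ n ∈ Finset.Icc 1 N, ∑ p ∈ P, (if p ∣ n then (1:ℝ) else 0) := by
    rw [Finset.sum_comm, hL, Finset.mul_sum, Finset.cast_card, ← Finset.sum_sub_distrib]
    apply Finset.sum_le_sum
    intro p hp
    rw [count_dvd p N (hP p hp).pos]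
    have h2 := Nat.lt_div_mul_add (a := N) (hP p hp).pos
    have hp0 : (0:ℝ) < p := by exact_mod_cast (hP p hp).pos
    have h3 : (N:ℝ) < (N / p : ℕ) * p + p := by exact_mod_cast h2
    have : (N:ℝ) * (1 / p) < (N / p : ℕ) + 1 := by
      rw [mul_one_div, div_lt_iff₀ hp0]; linarith
    push_cast at this ⊢
    linarith
  have h2 : ∑ n ∈ Finset.Icc 1 N, (∑ p ∈ P, (if p ∣ n then (1:ℝ) else 0)) ^ 2 ≤ N * L ^ 2 + N * L := by
    have e : ∀ n, (∑ p ∈ P, (if p ∣ n then (1:ℝ) else 0)) ^ 2 =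
        ∑ p ∈ P, ∑ q ∈ P, (if p ∣ n then (1:ℝ) else 0) * (if q ∣ n then (1:ℝ) else 0) := by
      intro n; rw [sq, Finset.sum_mul_sum]
    simp_rw [e]
    rw [Finset.sum_comm]
    have e2 : (N:ℝ) * L ^ 2 + N * L = ∑ p ∈ P, ∑ q ∈ P, ((N:ℝ) * ((1 / p) * (1 / q)) + if p = q then (N:ℝ) * (1 / p) else 0) := by
      simp_rw [Finset.sum_add_distrib]
      congr 1
      · rw [sq, hL, Finset.sum_mul_sum, Finset.mul_sum]
        simp_rw [Finset.mul_sum]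
      · rw [hL, Finset.mul_sum]
        apply Finset.sum_congr rfl
        intro p hp
        rw [Finset.sum_ite_eq, if_pos hp]
    rw [e2]
    apply Finset.sum_le_sum
    intro p hp
    rw [Finset.sum_comm]
    apply Finset.sum_le_sum
    intro q hq
    by_cases hpq : p = q
    · subst hpq
      have : ∀ n : ℕ, (if p ∣ n then (1:ℝ) else 0) * (if p ∣ n then (1:ℝ) else 0) = if p ∣ n then (1:ℝ) else 0 := by
        intro n; split_ifs <;> simp
      simp_rw [this]
      rw [count_dvd p N (hP p hp).pos, if_pos trivial]
      have : ((N / p : ℕ) : ℝ) ≤ N / p := Nat.cast_div_le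
      have h3 : 0 ≤ (N:ℝ) * ((1 / p) * (1 / p)) := by positivity
      have h4 : (N:ℝ) * (1 / p) = N / p := mul_one_div _ _
      linarith
    · have hc : Nat.Coprime p q := (Nat.coprime_primes (hP p hp) (hP q hq)).2 hpq
      have : ∀ n : ℕ, (if p ∣ n then (1:ℝ) else 0) * (if q ∣ n then (1:ℝ) else 0) = if p * q ∣ n then (1:ℝ) else 0 := by
        intro n
        have : p * q ∣ n ↔ p ∣ n ∧ q ∣ n :=
          ⟨fun h => ⟨dvd_of_mul_right_dvd h, dvd_of_mul_left_dvd h⟩, fun h => hc.mul_dvd_of_dvd_of_dvd h.1 h.2⟩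
        by_cases h1 : p ∣ n <;> by_cases h2 : q ∣ n <;> simp [h1, h2, this]
      simp_rw [this]
      rw [count_dvd _ N (Nat.mul_pos (hP p hp).pos (hP q hq).pos), if_neg hpq, add_zero]
      have : ((N / (p * q) : ℕ) : ℝ) ≤ N / ((p * q : ℕ) : ℝ) := Nat.cast_div_le
      refine this.trans_eq ?_
      push_cast
      field_simp
  have e3 : ∑ n ∈ Finset.Icc 1 N, ((∑ p ∈ P, (if p ∣ n then (1:ℝ) else 0)) - L) ^ 2 =
      ∑ n ∈ Finset.Icc 1 N, (∑ p ∈ P, (if p ∣ n then (1:ℝ) else 0)) ^ 2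
      - 2 * L * ∑ n ∈ Finset.Icc 1 N, (∑ p ∈ P, (if p ∣ n then (1:ℝ) else 0)) + N * L ^ 2 := by
    rw [Finset.mul_sum, ← Finset.sum_sub_distrib]
    have : (N:ℝ) * L ^ 2 = ∑ n ∈ Finset.Icc 1 N, L ^ 2 := by simp
    rw [this, ← Finset.sum_add_distrib]
    apply Finset.sum_congr rfl
    intro n _
    ring
  rw [e3]
  nlinarith

theorem moebius_mul_prime (p m : ℕ) (hp : p.Prime) :
    ‖(ArithmeticFunction.moebius (p * m) : ℂ) + ArithmeticFunction.moebius m‖ ≤ if p ∣ m then 1 else 0 := by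
  by_cases h : p ∣ m
  · rw [if_pos h]
    have : ArithmeticFunction.moebius (p * m) = 0 := by
      apply ArithmeticFunction.moebius_eq_zero_of_not_squarefree
      intro hsq
      exact (Nat.Prime.coprime_iff_not_dvd hp).1 (Nat.coprime_of_squarefree_mul hsq) h
    rw [this]
    simpa using moebius_norm_le m
  · rw [if_neg h, ArithmeticFunction.isMultiplicative_moebius.map_mul_of_coprime
      ((Nat.Prime.coprime_iff_not_dvd hp).2 h), ArithmeticFunction.moebius_apply_prime hp]
    simp

theorem sq_sum_norm_le (N : ℕ) (f : ℕ → ℂ) (w : ℕ → ℝ) (hw : ∀ n, ‖f n‖ ≤ w n) :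
    ‖∑ n ∈ Finset.Icc 1 N, f n‖ ^ 2 ≤ N * ∑ n ∈ Finset.Icc 1 N, w n ^ 2 := by
  have h1 : ‖∑ n ∈ Finset.Icc 1 N, f n‖ ≤ ∑ n ∈ Finset.Icc 1 N, w n := norm_sum_le_of_le _ fun n _ => hw n
  have h2 := sq_sum_le_card_mul_sum_sq (s := Finset.Icc 1 N) (f := w)
  simp only [Nat.card_Icc, Nat.add_sub_cancel] at h2
  refine le_trans ?_ h2
  gcongr

def koff (F : ℕ → ℂ) (P : Finset ℕ) (N : ℕ) : ℂ :=
  ∑ p ∈ P, ∑ q ∈ P, if p = q then 0 else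
    ∑ m ∈ Finset.Icc 1 (N / (max p q)), F (p * m) * (starRingEnd ℂ) (F (q * m))

theorem katai_fin (F : ℕ → ℂ) (hF : ∀ n, ‖F n‖ ≤ 1) (P : Finset ℕ) (hP : ∀ p ∈ P, p.Prime) (N : ℕ)
    (L C : ℝ) (hL : L = ∑ p ∈ P, (1 / p : ℝ)) (hC : ∑ p ∈ P, (1 / (p:ℝ) ^ 2) ≤ C) :
    L ^ 2 * ‖∑ n ∈ Finset.Icc 1 N, (ArithmeticFunction.moebius n : ℂ) * F n‖ ^ 2 ≤
      3 * (N * (N * L + 2 * L * P.card) + (C * N) ^ 2 + N * (N * L + ‖koff F P N‖)) := by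
  have hL0 : 0 ≤ L := by rw [hL]; exact Finset.sum_nonneg fun p _ => by positivity
  set μ : ℕ → ℂ := fun n => (ArithmeticFunction.moebius n : ℂ) with hμ
  set g : ℕ → ℂ := fun m => ∑ p ∈ P, if m ≤ N / p then F (p * m) else 0 with hg
  set T1 : ℂ := ∑ n ∈ Finset.Icc 1 N, μ n * F n * ((L - ∑ p ∈ P, (if p ∣ n then (1:ℝ) else 0) : ℝ) : ℂ)
  set T2 : ℂ := ∑ p ∈ P, ∑ m ∈ Finset.Icc 1 (N / p), (μ (p * m) + μ m) * F (p * m)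
  set T3 : ℂ := ∑ m ∈ Finset.Icc 1 N, μ m * g m
  have hT3 : T3 = ∑ p ∈ P, ∑ m ∈ Finset.Icc 1 (N / p), μ m * F (p * m) := by
    simp only [T3, hg, Finset.mul_sum]
    rw [Finset.sum_comm]
    apply Finset.sum_congr rfl
    intro p hp
    rw [← sum_trunc (N / p) N (Nat.div_le_self _ _)]
    apply Finset.sum_congr rfl
    intro m _
    split_ifs <;> simp
  have hdec : (L:ℂ) * ∑ n ∈ Finset.Icc 1 N, μ n * F n = T1 + T2 - T3 := by
    have e : T2 - T3 = ∑ n ∈ Finset.Icc 1 N, μ n * F n * ((∑ p ∈ P, (if p ∣ n then (1:ℝ) else 0) : ℝ) : ℂ) := by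
      rw [hT3]
      simp only [T2]
      rw [← Finset.sum_sub_distrib]
      push_cast
      simp_rw [Finset.mul_sum]
      rw [Finset.sum_comm]
      apply Finset.sum_congr rfl
      intro p hp
      have : ∀ n, μ n * F n * (if p ∣ n then (1:ℂ) else 0) = if p ∣ n then μ n * F n else 0 := by
        intro n; split_ifs <;> simp
      simp only [apply_ite Complex.ofReal, Complex.ofReal_one, Complex.ofReal_zero]
      simp_rw [this]
      rw [sum_dvd_eq p N (hP p hp).pos, ← Finset.sum_sub_distrib]
      apply Finset.sum_congr rfl
      intro m _
      ring
    rw [add_sub_assoc, e]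
    simp only [T1]
    rw [← Finset.sum_add_distrib, Finset.mul_sum]
    apply Finset.sum_congr rfl
    intro n _
    push_cast
    ring
  have hμ1 : ∀ n, ‖μ n‖ ≤ 1 := moebius_norm_le
  have b1 : ‖T1‖ ^ 2 ≤ N * (N * L + 2 * L * P.card) := by
    refine (sq_sum_norm_le N _ (fun n => |(∑ p ∈ P, (if p ∣ n then (1:ℝ) else 0)) - L|) ?_).trans ?_
    · intro n
      rw [norm_mul, norm_mul, Complex.norm_real, Real.norm_eq_abs, abs_sub_comm]
      have h1 := hμ1 n
      have h2 := hF n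
      calc _ ≤ 1 * 1 * |(∑ p ∈ P, (if p ∣ n then (1:ℝ) else 0)) - L| := by gcongr
        _ = _ := by ring
    · simp only [sq_abs]
      gcongr
      exact turan_kubilius P hP N L hL
  have b2 : ‖T2‖ ≤ C * N := by
    calc ‖T2‖ ≤ ∑ p ∈ P, (1 / (p:ℝ) ^ 2) * N := by
          refine norm_sum_le_of_le _ fun p hp => ?_
          have hp0 := (hP p hp).pos
          calc _ ≤ ∑ m ∈ Finset.Icc 1 (N / p), (if p ∣ m then (1:ℝ) else 0) := by
                refine norm_sum_le_of_le _ fun m _ => ?_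
                rw [norm_mul]
                have h1 := moebius_mul_prime p m (hP p hp)
                have h2 := hF (p * m)
                refine (mul_le_of_le_one_right (norm_nonneg _) h2).trans h1
            _ = ((N / p / p : ℕ) : ℝ) := count_dvd _ _ hp0
            _ ≤ _ := by
                rw [Nat.div_div_eq_div_mul]
                refine Nat.cast_div_le.trans_eq ?_
                push_cast
                field_simp
      _ ≤ C * N := by rw [← Finset.sum_mul]; gcongr
  have b3 : ‖T3‖ ^ 2 ≤ N * (N * L + ‖koff F P N‖) := by
    refine (sq_sum_norm_le N _ (fun n => ‖g n‖) ?_).trans ?_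
    · intro n
      rw [norm_mul]
      exact mul_le_of_le_one_left (norm_nonneg _) (hμ1 n)
    · gcongr
      have e : ((∑ m ∈ Finset.Icc 1 N, ‖g m‖ ^ 2 : ℝ) : ℂ) =
          (∑ p ∈ P, ∑ m ∈ Finset.Icc 1 (N / p), F (p * m) * (starRingEnd ℂ) (F (p * m))) + koff F P N := by
        unfold koff
        rw [← Finset.sum_add_distrib]
        have e1 : ∀ m, ((‖g m‖ ^ 2 : ℝ) : ℂ) = ∑ p ∈ P, ∑ q ∈ P,
            if m ≤ N / (max p q) then F (p * m) * (starRingEnd ℂ) (F (q * m)) else 0 := by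
          intro m
          rw [← Complex.normSq_eq_norm_sq, ← Complex.mul_conj]
          simp only [hg, map_sum]
          rw [Finset.sum_mul_sum]
          apply Finset.sum_congr rfl
          intro p hp
          apply Finset.sum_congr rfl
          intro q hq
          have : m ≤ N / max p q ↔ m ≤ N / p ∧ m ≤ N / q := by
            have hp0 := (hP p hp).pos
            have hq0 := (hP q hq).pos
            rcases le_total p q with h | h
            · rw [max_eq_right h]
              have := Nat.div_le_div_left h hp0 (a := N)
              omega
            · rw [max_eq_left h]
              have := Nat.div_le_div_left h hq0 (a := N)
              omega
          by_cases h1 : m ≤ N / p <;> by_cases h2 : m ≤ N / q <;> simp [h1, h2, this]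
        push_cast at e1 ⊢
        simp_rw [e1]
        rw [Finset.sum_comm]
        apply Finset.sum_congr rfl
        intro p hp
        rw [Finset.sum_comm]
        simp_rw [sum_trunc _ N (Nat.div_le_self N _)]
        rw [← Finset.add_sum_erase _ _ hp, ← Finset.add_sum_erase P (fun q => if p = q then (0:ℂ) else _) hp]
        simp only [max_self, if_true, zero_add]
        congr 1
        apply Finset.sum_congr rfl
        intro q hq
        rw [if_neg (Finset.ne_of_mem_erase hq).symm]
      have e' := congrArg norm e
      rw [Complex.norm_real, Real.norm_of_nonneg (Finset.sum_nonneg fun _ _ => by positivity)] at e'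
      rw [e']
      refine (norm_add_le _ _).trans ?_
      gcongr
      rw [hL, Finset.mul_sum]
      refine norm_sum_le_of_le _ fun p hp => ?_
      calc _ ≤ ∑ m ∈ Finset.Icc 1 (N / p), (1:ℝ) := by
            refine norm_sum_le_of_le _ fun m _ => ?_
            rw [norm_mul, RCLike.norm_conj]
            have := hF (p * m)
            nlinarith [norm_nonneg (F (p * m))]
        _ = ((N / p : ℕ) : ℝ) := by simp
        _ ≤ _ := by rw [mul_one_div]; exact Nat.cast_div_le
  have hn : L * ‖∑ n ∈ Finset.Icc 1 N, μ n * F n‖ ≤ ‖T1‖ + ‖T2‖ + ‖T3‖ := by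
    have : L * ‖∑ n ∈ Finset.Icc 1 N, μ n * F n‖ = ‖(L:ℂ) * ∑ n ∈ Finset.Icc 1 N, μ n * F n‖ := by
      rw [norm_mul, Complex.norm_real, Real.norm_of_nonneg hL0]
    rw [this, hdec]
    exact (norm_sub_le _ _).trans (by gcongr; exact norm_add_le _ _)
  have b2' : ‖T2‖ ^ 2 ≤ (C * N) ^ 2 := by gcongr
  rw [← mul_pow]
  have h5 : (L * ‖∑ n ∈ Finset.Icc 1 N, μ n * F n‖) ^ 2 ≤ (‖T1‖ + ‖T2‖ + ‖T3‖) ^ 2 := by gcongr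
  nlinarith [sq_nonneg (‖T1‖ - ‖T2‖), sq_nonneg (‖T1‖ - ‖T3‖), sq_nonneg (‖T2‖ - ‖T3‖)]

theorem exists_primes (B : ℝ) : ∃ P : Finset ℕ, (∀ p ∈ P, p.Prime) ∧ B ≤ ∑ p ∈ P, (1 / p : ℝ) := by
  by_contra! h
  apply Nat.Primes.not_summable_one_div
  apply summable_of_sum_le (c := B) (fun p => by positivity)
  intro u
  have := h (u.image (fun q : Nat.Primes => (q : ℕ))) ?_
  · rw [Finset.sum_image (g := fun q : Nat.Primes => (q : ℕ)) (fun x _ y _ hxy => Subtype.ext hxy)] at this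
    exact this.le
  · intro p hp
    obtain ⟨q, _, rfl⟩ := Finset.mem_image.1 hp
    exact q.2

theorem katai (F : ℕ → ℂ) (hF : ∀ n, ‖F n‖ ≤ 1)
    (hpq : ∀ p q : ℕ, p.Prime → q.Prime → p ≠ q → Tendsto (fun N : ℕ => (1 / N : ℂ) *
      ∑ m ∈ Finset.Icc 1 N, F (p * m) * (starRingEnd ℂ) (F (q * m))) atTop (𝓝 0)) : mavg F := by
  have hsum : Summable (fun n : ℕ => 1 / (n:ℝ) ^ 2) := Real.summable_one_div_nat_pow.2 (by norm_num)
  set C := ∑' n : ℕ, 1 / (n:ℝ) ^ 2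
  have hC0 : 0 ≤ C := tsum_nonneg fun n => by positivity
  unfold mavg
  rw [Metric.tendsto_atTop]
  intro ε hε
  obtain ⟨P, hP, hB⟩ := exists_primes ((12 + 6 * C ^ 2 + 3) / ε ^ 2 + 1)
  set L := ∑ p ∈ P, (1 / p : ℝ) with hL
  have hL1 : 1 ≤ L := le_trans (by have : 0 ≤ (12 + 6 * C ^ 2 + 3) / ε ^ 2 := by positivity
                                   linarith) hB
  have hCP : ∑ p ∈ P, (1 / (p:ℝ) ^ 2) ≤ C := hsum.sum_le_tsum P (fun n _ => by positivity)
  have hoff : Tendsto (fun N : ℕ => (1 / N : ℂ) * koff F P N) atTop (𝓝 0) := by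
    have := tendsto_finsetSum P fun p hp => tendsto_finsetSum P (f := fun q (N : ℕ) => (1 / N : ℂ) * (if p = q then 0 else
    ∑ m ∈ Finset.Icc 1 (N / (max p q)), F (p * m) * (starRingEnd ℂ) (F (q * m)))) (a := fun _ => 0) (x := atTop) fun q hq => by
      by_cases h : p = q
      · simp [h]
      · simp only [if_neg h]
        exact avg_div _ (hpq p q (hP p hp) (hP q hq) h) _ (lt_max_of_lt_left (hP p hp).pos)
    simp only [Finset.sum_const_zero] at this
    refine this.congr fun N => ?_
    unfold koff
    simp_rw [Finset.mul_sum]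
  have hoff' := hoff.norm
  rw [norm_zero] at hoff'
  have hc1 : Tendsto (fun N : ℕ => (2 * L * P.card) / (N:ℝ)) atTop (𝓝 0) :=
    tendsto_const_div_atTop_nhds_zero_nat _
  obtain ⟨N0, hN0⟩ := eventually_atTop.1 ((hoff'.eventually_lt_const (by positivity : 0 < L / 2)).and
    ((hc1.eventually_lt_const (by positivity : 0 < L / 2)).and (eventually_gt_atTop 0)))
  refine ⟨N0, fun N hN => ?_⟩
  obtain ⟨a1, a2, a3⟩ := hN0 N hN
  have hNp : (0:ℝ) < N := by exact_mod_cast a3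
  have hk := katai_fin F hF P hP N L C hL hCP
  rw [dist_zero_right, norm_mul]
  set S := ‖∑ n ∈ Finset.Icc 1 N, (ArithmeticFunction.moebius n : ℂ) * F n‖
  have hnn : ‖(1 / N : ℂ)‖ = 1 / N := by simp
  rw [hnn]
  rw [norm_mul, hnn, one_div, inv_mul_lt_iff₀ hNp] at a1
  rw [div_lt_iff₀ hNp] at a2
  have hS : L ^ 2 * S ^ 2 < ε ^ 2 * N ^ 2 * L ^ 2 := by
    calc L ^ 2 * S ^ 2 ≤ 3 * (N * (N * L + 2 * L * P.card) + (C * N) ^ 2 + N * (N * L + ‖koff F P N‖)) := hk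
      _ ≤ 3 * (N * (N * L + L / 2 * N) + (C * N) ^ 2 + N * (N * L + N * (L / 2))) := by gcongr
      _ = N ^ 2 * (9 * L + 3 * C ^ 2) := by ring
      _ ≤ N ^ 2 * (L * (12 + 6 * C ^ 2 + 3)) := by
          gcongr
          nlinarith [sq_nonneg C, mul_le_mul_of_nonneg_left hL1 (sq_nonneg C)]
      _ < N ^ 2 * (L * (ε ^ 2 * L)) := by
          gcongr
          have : (12 + 6 * C ^ 2 + 3) / ε ^ 2 < L := by linarith
          rw [div_lt_iff₀ (by positivity)] at this
          linarith
      _ = _ := by ring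
  have hS2 : S ^ 2 < (ε * N) ^ 2 := by
    have : L ^ 2 * S ^ 2 < L ^ 2 * (ε * N) ^ 2 := by rw [mul_pow]; linarith
    exact lt_of_mul_lt_mul_left this (by positivity)
  have hS3 : S < ε * N := lt_of_pow_lt_pow_left₀ 2 (by positivity) hS2
  rw [one_div, inv_mul_lt_iff₀ hNp]
  linarith

end Katai

section Weyl
open Topology

def avg0 (w : ℕ → ℂ) : Prop :=
  Tendsto (fun N : ℕ => (1 / N : ℂ) * ∑ n ∈ Finset.Icc 1 N, w n) atTop (𝓝 0)

theorem shift_sum (w : ℕ → ℂ) (hw : ∀ n, ‖w n‖ ≤ 1) (k N : ℕ) :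
    ‖∑ n ∈ Finset.Icc 1 N, w (n + k) - ∑ n ∈ Finset.Icc 1 N, w n‖ ≤ 2 * k := by
  induction k with
  | zero => simp
  | succ k ih =>
    have e : ∀ N : ℕ, ∑ n ∈ Finset.Icc 1 N, w (n + (k + 1)) =
        ∑ n ∈ Finset.Icc 1 N, w (n + k) + w (N + 1 + k) - w (1 + k) := by
      intro N
      induction N with
      | zero => simp
      | succ N ih2 =>
        rw [Finset.sum_Icc_succ_top (by omega), ih2, Finset.sum_Icc_succ_top (by omega)]
        have : N + 1 + (k + 1) = N + 1 + 1 + k := by ring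
        rw [this]; ring
    rw [e]
    have e2 : ∑ n ∈ Finset.Icc 1 N, w (n + k) + w (N + 1 + k) - w (1 + k) - ∑ n ∈ Finset.Icc 1 N, w n
      = (∑ n ∈ Finset.Icc 1 N, w (n + k) - ∑ n ∈ Finset.Icc 1 N, w n) + (w (N + 1 + k) - w (1 + k)) := by ring
    rw [e2]
    refine (norm_add_le _ _).trans ?_
    have h1 := hw (N + 1 + k)
    have h2 := hw (1 + k)
    have h3 := norm_sub_le (w (N + 1 + k)) (w (1 + k))
    push_cast
    linarith

theorem avg0_of_bdd (S : ℕ → ℂ) (B : ℝ) (hB : ∀ N, ‖S N‖ ≤ B) :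
    Tendsto (fun N : ℕ => (1 / N : ℂ) * S N) atTop (𝓝 0) := by
  rw [tendsto_zero_iff_norm_tendsto_zero]
  refine squeeze_zero (fun _ => norm_nonneg _) (fun N => ?_) (tendsto_const_div_atTop_nhds_zero_nat B)
  rw [norm_mul]
  simp only [one_div, norm_inv, RCLike.norm_natCast]
  rw [inv_mul_eq_div]
  gcongr
  exact hB N

theorem avg0_shift (w : ℕ → ℂ) (hw : ∀ n, ‖w n‖ ≤ 1) (k : ℕ) (h : avg0 w) :
    avg0 (fun n => w (n + k)) := by
  have := h.add (avg0_of_bdd _ _ (fun N => shift_sum w hw k N))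
  rw [add_zero] at this
  refine this.congr fun N => ?_
  ring

theorem avg0_conj (w : ℕ → ℂ) (h : avg0 w) : avg0 (fun n => (starRingEnd ℂ) (w n)) := by
  have := (Complex.continuous_conj.tendsto 0).comp h
  rw [map_zero] at this
  refine this.congr fun N => ?_
  simp

theorem vdc (u : ℕ → ℂ) (hu : ∀ n, ‖u n‖ ≤ 1)
    (hc : ∀ h : ℕ, 1 ≤ h → avg0 (fun n => u (n + h) * (starRingEnd ℂ) (u n))) : avg0 u := by
  have hcorr : ∀ a b : ℕ, a ≠ b → avg0 (fun n => u (n + a) * (starRingEnd ℂ) (u (n + b))) := by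
    have hlt : ∀ a b : ℕ, b < a → avg0 (fun n => u (n + a) * (starRingEnd ℂ) (u (n + b))) := by
      intro a b hab
      obtain ⟨h, rfl⟩ := Nat.exists_eq_add_of_lt hab
      have := avg0_shift _ (fun n => ?_) b (hc (h + 1) (by omega))
      · refine this.congr fun N => ?_
        congr 1
        apply Finset.sum_congr rfl
        intro n _
        have : n + b + (h + 1) = n + (b + h + 1) := by ring
        simp only [this]
      · rw [norm_mul, RCLike.norm_conj]
        have h1 := hu n
        have h2 := hu (n + (h + 1))
        nlinarith [norm_nonneg (u n), norm_nonneg (u (n + (h+1)))]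
    intro a b hab
    rcases lt_or_gt_of_ne hab with h | h
    · have := avg0_conj _ (hlt b a h)
      refine this.congr fun N => ?_
      congr 1
      apply Finset.sum_congr rfl
      intro n _
      simp [mul_comm]
    · exact hlt a b h
  unfold avg0
  rw [Metric.tendsto_atTop]
  intro ε hε
  obtain ⟨H, hH⟩ := exists_nat_gt (5 / ε ^ 2)
  have hH0 : (0:ℝ) < H := lt_trans (by positivity) hH
  have hH1 : (1:ℝ) ≤ H := by
    have : 0 < H := by exact_mod_cast hH0
    exact_mod_cast this
  set off : ℕ → ℂ := fun N => ∑ a ∈ Finset.range H, ∑ b ∈ Finset.range H,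
    if a = b then 0 else ∑ n ∈ Finset.Icc 1 N, u (n + a) * (starRingEnd ℂ) (u (n + b)) with hoffd
  have hoff : Tendsto (fun N : ℕ => (1 / N : ℂ) * off N) atTop (𝓝 0) := by
    have := tendsto_finsetSum (Finset.range H) fun a ha => tendsto_finsetSum (Finset.range H)
      (f := fun b (N : ℕ) => (1 / N : ℂ) * (if a = b then 0 else
        ∑ n ∈ Finset.Icc 1 N, u (n + a) * (starRingEnd ℂ) (u (n + b)))) (a := fun _ => 0) (x := atTop) fun b hb => by
      by_cases h : a = b
      · simp [h]
      · simp only [if_neg h]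
        exact hcorr a b h
    simp only [Finset.sum_const_zero] at this
    refine this.congr fun N => ?_
    simp only [hoffd]
    simp_rw [Finset.mul_sum]
  have hoff' := hoff.norm
  rw [norm_zero] at hoff'
  have hc1 : Tendsto (fun N : ℕ => (8 * (H:ℝ) ^ 4) / (N:ℝ)) atTop (𝓝 0) :=
    tendsto_const_div_atTop_nhds_zero_nat _
  obtain ⟨N0, hN0⟩ := eventually_atTop.1 ((hoff'.eventually_lt_const one_pos).and
    ((hc1.eventually_lt_const one_pos).and (eventually_gt_atTop 0)))
  refine ⟨N0, fun N hN => ?_⟩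
  obtain ⟨a1, a2, a3⟩ := hN0 N hN
  have hNp : (0:ℝ) < N := by exact_mod_cast a3
  have hN1 : (1:ℝ) ≤ N := by exact_mod_cast a3
  have hnn : ‖(1 / N : ℂ)‖ = 1 / N := by simp
  rw [dist_zero_right, norm_mul, hnn]
  rw [norm_mul, hnn, one_div, inv_mul_lt_iff₀ hNp, mul_one] at a1
  rw [div_lt_iff₀ hNp, one_mul] at a2
  set v : ℕ → ℂ := fun n => ∑ a ∈ Finset.range H, u (n + a) with hv
  set S := ∑ n ∈ Finset.Icc 1 N, u n with hS
  have h1 : ‖(H:ℂ) * S - ∑ n ∈ Finset.Icc 1 N, v n‖ ≤ 2 * H ^ 2 := by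
    have : (H:ℂ) * S - ∑ n ∈ Finset.Icc 1 N, v n =
        ∑ a ∈ Finset.range H, (S - ∑ n ∈ Finset.Icc 1 N, u (n + a)) := by
      simp only [hv]
      rw [Finset.sum_comm, Finset.sum_sub_distrib]
      simp
    rw [this]
    calc _ ≤ ∑ a ∈ Finset.range H, (2 * H : ℝ) := by
          refine norm_sum_le_of_le _ fun a ha => ?_
          rw [norm_sub_rev]
          refine (shift_sum u hu a N).trans ?_
          have : (a:ℝ) ≤ H := by exact_mod_cast (Finset.mem_range.1 ha).le
          linarith
      _ = _ := by simp; ring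
  have h2 : ‖∑ n ∈ Finset.Icc 1 N, v n‖ ^ 2 ≤ N * (N * H + ‖off N‖) := by
    refine (sq_sum_norm_le N _ (fun n => ‖v n‖) (fun n => le_rfl)).trans ?_
    gcongr
    have e : ((∑ m ∈ Finset.Icc 1 N, ‖v m‖ ^ 2 : ℝ) : ℂ) =
        (∑ a ∈ Finset.range H, ∑ n ∈ Finset.Icc 1 N, u (n + a) * (starRingEnd ℂ) (u (n + a))) + off N := by
      simp only [hoffd]
      rw [← Finset.sum_add_distrib]
      have e1 : ∀ m, ((‖v m‖ ^ 2 : ℝ) : ℂ) = ∑ a ∈ Finset.range H, ∑ b ∈ Finset.range H,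
          u (m + a) * (starRingEnd ℂ) (u (m + b)) := by
        intro m
        rw [← Complex.normSq_eq_norm_sq, ← Complex.mul_conj]
        simp only [hv, map_sum]
        rw [Finset.sum_mul_sum]
      push_cast at e1 ⊢
      simp_rw [e1]
      rw [Finset.sum_comm]
      apply Finset.sum_congr rfl
      intro p hp
      rw [Finset.sum_comm]
      rw [← Finset.add_sum_erase _ _ hp, ← Finset.add_sum_erase _ (fun q => if p = q then (0:ℂ) else _) hp]
      simp only [if_true, zero_add]
      congr 1
      apply Finset.sum_congr rfl
      intro q hq
      rw [if_neg (Finset.ne_of_mem_erase hq).symm]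
    have e' := congrArg norm e
    rw [Complex.norm_real, Real.norm_of_nonneg (Finset.sum_nonneg fun _ _ => by positivity)] at e'
    rw [e']
    refine (norm_add_le _ _).trans ?_
    gcongr
    calc _ ≤ ∑ a ∈ Finset.range H, (N:ℝ) := by
          refine norm_sum_le_of_le _ fun a _ => ?_
          refine (norm_sum_le_of_le _ (fun n _ => (?_ : _ ≤ (1:ℝ)))).trans_eq (by simp)
          rw [norm_mul, RCLike.norm_conj]
          have := hu (n + a)
          nlinarith [norm_nonneg (u (n + a))]
      _ = _ := by simp; ring
  have h3 : H * ‖S‖ ≤ ‖∑ n ∈ Finset.Icc 1 N, v n‖ + 2 * H ^ 2 := by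
    have h4 := norm_le_norm_sub_add ((H:ℂ) * S) (∑ n ∈ Finset.Icc 1 N, v n)
    rw [norm_mul, RCLike.norm_natCast] at h4
    linarith
  have h5 : (H * ‖S‖) ^ 2 ≤ (‖∑ n ∈ Finset.Icc 1 N, v n‖ + 2 * H ^ 2) ^ 2 := by gcongr
  have h6 : ((H:ℝ) * ‖S‖) ^ 2 < (H:ℝ) ^ 2 * (ε * N) ^ 2 := by
    have g1 : ((H:ℝ) * ‖S‖) ^ 2 ≤ 2 * ‖∑ n ∈ Finset.Icc 1 N, v n‖ ^ 2 + 8 * (H:ℝ) ^ 4 := by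
      refine h5.trans ?_
      have := sq_nonneg (‖∑ n ∈ Finset.Icc 1 N, v n‖ - 2 * (H:ℝ) ^ 2)
      ring_nf at this ⊢
      linarith
    have g2 : 8 * (H:ℝ) ^ 4 ≤ (N:ℝ) * N := by nlinarith
    have g3 : (N:ℝ) * (N * H + ‖off N‖) ≤ (N:ℝ) * (N * H + N) := by gcongr
    have g4 : 2 * ((N:ℝ) * (N * H + N)) + (N:ℝ) * N ≤ (N:ℝ) ^ 2 * (5 * H) := by
      nlinarith [sq_nonneg (N:ℝ), mul_le_mul_of_nonneg_left hH1 (sq_nonneg (N:ℝ))]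
    have g5 : (N:ℝ) ^ 2 * (5 * H) < (N:ℝ) ^ 2 * ((ε ^ 2 * H) * H) := by
      gcongr
      rw [div_lt_iff₀ (by positivity)] at hH
      linarith
    have g6 : (N:ℝ) ^ 2 * ((ε ^ 2 * H) * H) = (H:ℝ) ^ 2 * (ε * N) ^ 2 := by ring
    linarith
  rw [mul_pow] at h6
  have h8 : ‖S‖ ^ 2 < (ε * N) ^ 2 := lt_of_mul_lt_mul_left h6 (by positivity)
  have h9 : ‖S‖ < ε * N := lt_of_pow_lt_pow_left₀ 2 (by positivity) h8
  rw [one_div, inv_mul_lt_iff₀ hNp]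
  linarith

def ee (x : ℝ) : ℂ := Complex.exp ((2 * Real.pi * x : ℝ) * Complex.I)

theorem ee_add (x y : ℝ) : ee (x + y) = ee x * ee y := by
  unfold ee; rw [← Complex.exp_add]; congr 1; push_cast; ring

theorem ee_norm (x : ℝ) : ‖ee x‖ = 1 := Complex.norm_exp_ofReal_mul_I _

theorem ee_int (z : ℤ) : ee z = 1 := by
  unfold ee; rw [Complex.exp_eq_one_iff]; exact ⟨z, by push_cast; ring⟩

theorem ee_eq_one (x : ℝ) (h : ee x = 1) : ∃ z : ℤ, x = z := by
  unfold ee at h; rw [Complex.exp_eq_one_iff] at h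
  obtain ⟨z, hz⟩ := h
  refine ⟨z, ?_⟩
  have hpi : (2 * Real.pi * Complex.I : ℂ) ≠ 0 := Complex.two_pi_I_ne_zero
  have : (2 * Real.pi * Complex.I : ℂ) * x = (2 * Real.pi * Complex.I) * z := by
    push_cast at hz; linear_combination hz
  exact_mod_cast mul_left_cancel₀ hpi this

theorem ee_conj (x y : ℝ) : ee x * (starRingEnd ℂ) (ee y) = ee (x - y) := by
  unfold ee; rw [← Complex.exp_conj, ← Complex.exp_add]
  congr 1
  rw [map_mul, Complex.conj_ofReal, Complex.conj_I]; push_cast; ring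

def KQ : Subfield ℝ := (Rat.castHom ℝ).fieldRange

theorem exists_den (c : ℕ → ℝ) (n : ℕ) (hc : ∀ l, 2 ≤ l → c l ∈ KQ) :
    ∃ D : ℕ, 0 < D ∧ ∀ l, 2 ≤ l → l < n → ∃ z : ℤ, c l * D = z := by
  induction n with
  | zero => exact ⟨1, one_pos, fun l _ h => by omega⟩
  | succ n ih =>
    obtain ⟨D, hD, h⟩ := ih
    by_cases hn : 2 ≤ n
    · obtain ⟨q, hq⟩ := hc n hn
      have hq' : (q : ℝ) = c n := hq
      refine ⟨D * q.den, Nat.mul_pos hD q.den_pos, fun l hl hln => ?_⟩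
      rcases Nat.lt_succ_iff_lt_or_eq.1 hln with h1 | rfl
      · obtain ⟨z, hz⟩ := h l hl h1
        refine ⟨z * q.den, ?_⟩
        push_cast
        rw [← mul_assoc, hz]
      · refine ⟨q.num * D, ?_⟩
        rw [← hq']
        have : (q:ℝ) * q.den = q.num := by exact_mod_cast Rat.mul_den_eq_num q
        push_cast
        linear_combination (D:ℝ) * this
    · exact ⟨D, hD, fun l hl hln => h l hl (by omega)⟩

theorem poly_period (Q : ℝ[X]) (hQ : ∀ l, 2 ≤ l → Q.coeff l ∈ KQ) :
    ∃ D : ℕ, 0 < D ∧ ∀ k n : ℕ, ∃ z : ℤ,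
      Q.eval ((n + D * k : ℕ) : ℝ) = Q.eval (n : ℝ) + Q.coeff 1 * (D * k) + z := by
  obtain ⟨D, hD, h⟩ := exists_den Q.coeff (Q.natDegree + 2) hQ
  refine ⟨D, hD, fun k n => ?_⟩
  have hterm : ∀ l ∈ Finset.range (Q.natDegree + 2), ∃ z : ℤ,
      Q.coeff l * ((n + D * k : ℕ) : ℝ) ^ l - Q.coeff l * (n:ℝ) ^ l
        - (if l = 1 then Q.coeff 1 * (D * k) else 0) = z := by
    intro l hl
    rcases lt_or_ge l 2 with h2 | h2
    · interval_cases l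
      · exact ⟨0, by simp⟩
      · exact ⟨0, by simp; ring⟩
    · obtain ⟨z, hz⟩ := h l h2 (Finset.mem_range.1 hl)
      have hd : (D:ℤ) ∣ ((n + D * k : ℕ) : ℤ) ^ l - (n:ℤ) ^ l := by
        refine dvd_trans ?_ (sub_dvd_pow_sub_pow _ _ l)
        push_cast
        exact ⟨k, by ring⟩
      obtain ⟨w, hw⟩ := hd
      refine ⟨z * w, ?_⟩
      rw [if_neg (by omega), sub_zero, ← mul_sub]
      have hw' : ((n + D * k : ℕ) : ℝ) ^ l - (n:ℝ) ^ l = D * w := by exact_mod_cast hw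
      rw [hw', ← mul_assoc, hz]
      push_cast; rfl
  choose! z hz using hterm
  refine ⟨∑ l ∈ Finset.range (Q.natDegree + 2), z l, ?_⟩
  have hs := Finset.sum_congr rfl hz
  rw [Finset.sum_sub_distrib, Finset.sum_sub_distrib] at hs
  rw [Polynomial.eval_eq_sum_range' (show Q.natDegree < Q.natDegree + 2 by omega),
    Polynomial.eval_eq_sum_range' (show Q.natDegree < Q.natDegree + 2 by omega)]
  rw [Finset.sum_ite_eq' , if_pos (by simp)] at hs
  push_cast at hs ⊢
  linarith

theorem weyl_base (Q : ℝ[X]) (h1 : Q.coeff 1 ∉ KQ) (hQ : ∀ l, 2 ≤ l → Q.coeff l ∈ KQ) :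
    avg0 (fun n => ee (Q.eval (n:ℝ))) := by
  obtain ⟨D, hD, h⟩ := poly_period Q hQ
  set ω := ee (Q.coeff 1 * D) with hω
  have hω1 : ω - 1 ≠ 0 := by
    intro h0
    obtain ⟨z, hz⟩ := ee_eq_one _ (sub_eq_zero.1 h0)
    apply h1
    have hD' : (D:ℝ) ≠ 0 := by exact_mod_cast hD.ne'
    have : Q.coeff 1 = (z:ℝ) / (D:ℝ) := by field_simp; exact hz
    rw [this]
    exact KQ.div_mem (intCast_mem KQ z) (natCast_mem KQ D)
  apply avg0_of_bdd _ (2 * D / ‖ω - 1‖)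
  intro N
  rw [le_div_iff₀ (norm_pos_iff.2 hω1), ← norm_mul]
  have := shift_sum (fun n => ee (Q.eval (n:ℝ))) (fun n => (ee_norm _).le) D N
  refine le_trans (le_of_eq ?_) this
  congr 1
  rw [mul_sub, mul_one, Finset.sum_mul]
  congr 1
  apply Finset.sum_congr rfl
  intro n _
  obtain ⟨z, hz⟩ := h 1 n
  simp only [mul_one, Nat.cast_one] at hz
  rw [hz, ee_add, ee_add, ee_int, mul_one]

theorem diff_coeff (Q : ℝ[X]) (h i : ℕ) (hQ : ∀ l, i + 2 ≤ l → Q.coeff l ∈ KQ) :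
    (Polynomial.taylor (h:ℝ) Q - Q).coeff i - (i + 1) * h * Q.coeff (i + 1) ∈ KQ := by
  have e : (Polynomial.taylor (h:ℝ) Q).coeff i =
      ∑ l ∈ Finset.range (Q.natDegree + i + 2), (l.choose i : ℝ) * Q.coeff l * (h:ℝ) ^ (l - i) := by
    rw [Polynomial.taylor_coeff, Polynomial.hasseDeriv_apply,
      Polynomial.sum_over_range' _ _ (Q.natDegree + i + 2) (by omega)]
    · simp [Polynomial.eval_finsetSum]
    · intro n; simp
  have e2 : (Polynomial.taylor (h:ℝ) Q - Q).coeff i - (i + 1) * h * Q.coeff (i + 1) =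
      ∑ l ∈ Finset.range (Q.natDegree + i + 2), ((l.choose i : ℝ) * Q.coeff l * (h:ℝ) ^ (l - i)
        - (if l = i then Q.coeff i else 0) - (if l = i + 1 then (i + 1) * h * Q.coeff (i + 1) else 0)) := by
    rw [Polynomial.coeff_sub, e, Finset.sum_sub_distrib, Finset.sum_sub_distrib, Finset.sum_ite_eq',
      Finset.sum_ite_eq', if_pos (by simp; omega), if_pos (by simp)]
  rw [e2]
  apply KQ.sum_mem
  intro l _
  rcases lt_trichotomy l i with hl | rfl | hl
  · rw [Nat.choose_eq_zero_of_lt hl, if_neg hl.ne, if_neg (by omega)]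
    simp
  · simp
  · by_cases hl2 : l = i + 1
    · subst hl2
      simp
      convert KQ.zero_mem using 1
      ring
    · rw [if_neg (by omega), if_neg hl2, sub_zero, sub_zero]
      exact KQ.mul_mem (KQ.mul_mem (natCast_mem KQ _) (hQ l (by omega))) (KQ.pow_mem (natCast_mem KQ h) _)

theorem weyl (j : ℕ) (hj : 1 ≤ j) : ∀ Q : ℝ[X], Q.coeff j ∉ KQ → (∀ l, j < l → Q.coeff l ∈ KQ) →
    avg0 (fun n => ee (Q.eval (n:ℝ))) := by
  induction j, hj using Nat.le_induction with
  | base => intro Q h1 h2; exact weyl_base Q h1 (fun l hl => h2 l (by omega))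
  | succ j hj ih =>
    intro Q h1 h2
    apply vdc _ (fun n => (ee_norm _).le)
    intro h hh
    have := ih (Polynomial.taylor (h:ℝ) Q - Q) ?_ ?_
    · refine this.congr fun N => ?_
      congr 1
      apply Finset.sum_congr rfl
      intro n _
      beta_reduce; rw [ee_conj]
      congr 1
      rw [Polynomial.eval_sub, Polynomial.taylor_eval]
      push_cast
      rfl
    · intro hm
      apply h1
      have h3 := KQ.sub_mem hm (diff_coeff Q h j (fun l hl => h2 l (by omega)))
      rw [sub_sub_cancel] at h3
      have hh' : (h:ℝ) ≠ 0 := by exact_mod_cast (by omega : h ≠ 0)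
      have hj' : ((j:ℝ) + 1) ≠ 0 := by positivity
      have h4 : ((j:ℝ) + 1) * h ∈ KQ := by
        have := natCast_mem KQ ((j + 1) * h)
        push_cast at this; exact this
      have : Q.coeff (j + 1) = (((j:ℝ) + 1) * h * Q.coeff (j + 1)) / (((j:ℝ) + 1) * h) := by
        field_simp
      rw [this]
      exact KQ.div_mem h3 h4
    · intro l hl
      have h3 := diff_coeff Q h l (fun i hi => h2 i (by omega))
      have h4 : ((l:ℝ) + 1) * h ∈ KQ := by
        have := natCast_mem KQ ((l + 1) * h)
        push_cast at this; exact this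
      have h5 := KQ.add_mem h3 (KQ.mul_mem h4 (h2 (l + 1) (by omega)))
      rwa [sub_add_cancel] at h5

theorem mavg_poly (Q : ℝ[X]) : mavg (fun n => ee (Q.eval (n:ℝ))) := by
  by_cases hall : ∀ l, 1 ≤ l → Q.coeff l ∈ KQ
  · obtain ⟨D, hD, h⟩ := poly_period Q (fun l hl => hall l (by omega))
    obtain ⟨q, hq⟩ := hall 1 le_rfl
    have hq' : (q : ℝ) = Q.coeff 1 := hq
    have hper : ∀ n : ℕ, ee (Q.eval ((n + D * q.den : ℕ) : ℝ)) = ee (Q.eval (n:ℝ)) := by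
      intro n
      obtain ⟨z, hz⟩ := h q.den n
      have : (q:ℝ) * q.den = q.num := by exact_mod_cast Rat.mul_den_eq_num q
      have e : Q.coeff 1 * (D * q.den) + z = ((q.num * D + z : ℤ) : ℝ) := by
        rw [← hq']; push_cast
        linear_combination (D:ℝ) * this
      rw [hz, add_assoc, e, ee_add, ee_int, mul_one]
    set M := D * q.den with hM
    have : NeZero M := ⟨(Nat.mul_pos hD q.den_pos).ne'⟩
    have hP : Function.Periodic (fun n : ℕ => ee (Q.eval (n:ℝ))) M := hper
    have := mavg_zmod (D := M) (fun b => ee (Q.eval ((b.val : ℕ) : ℝ)))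
    refine this.congr fun N => ?_
    congr 1
    apply Finset.sum_congr rfl
    intro n _
    congr 1
    simp only [ZMod.val_natCast]
    exact hP.map_mod_nat n
  · push Not at hall
    obtain ⟨l0, hl0, hl0'⟩ := hall
    classical
    set s := Q.support.filter (fun l => 1 ≤ l ∧ Q.coeff l ∉ KQ) with hs
    have hne : s.Nonempty := by
      refine ⟨l0, Finset.mem_filter.2 ⟨?_, hl0, hl0'⟩⟩
      rw [Polynomial.mem_support_iff]
      intro h0
      rw [h0] at hl0'
      exact hl0' KQ.zero_mem
    obtain ⟨j, hj, hmax⟩ := s.exists_max_image id hne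
    obtain ⟨_, hj1, hj2⟩ := Finset.mem_filter.1 hj
    have htop : ∀ l, j < l → Q.coeff l ∈ KQ := by
      intro l hl
      by_contra hc
      have : l ∈ s := by
        refine Finset.mem_filter.2 ⟨?_, by omega, hc⟩
        rw [Polynomial.mem_support_iff]
        intro h0
        rw [h0] at hc
        exact hc KQ.zero_mem
      have := hmax l this
      simp at this
      omega
    apply katai _ (fun n => (ee_norm _).le)
    intro p q hp hq hpq
    have hco : ∀ l, (Q.comp (C (p:ℝ) * X) - Q.comp (C (q:ℝ) * X)).coeff l = Q.coeff l * ((p:ℝ) ^ l - (q:ℝ) ^ l) := by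
      intro l
      rw [Polynomial.coeff_sub, Polynomial.comp_C_mul_X_coeff, Polynomial.comp_C_mul_X_coeff]
      ring
    have hK : ∀ l : ℕ, (p:ℝ) ^ l - (q:ℝ) ^ l ∈ KQ := fun l =>
      KQ.sub_mem (KQ.pow_mem (natCast_mem KQ p) l) (KQ.pow_mem (natCast_mem KQ q) l)
    have := weyl j hj1 (Q.comp (C (p:ℝ) * X) - Q.comp (C (q:ℝ) * X)) ?_ ?_
    · refine this.congr fun N => ?_
      congr 1
      apply Finset.sum_congr rfl
      intro n _
      beta_reduce; rw [ee_conj]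
      congr 1
      simp
    · rw [hco]
      intro hm
      apply hj2
      have hne0 : (p:ℝ) ^ j - (q:ℝ) ^ j ≠ 0 := by
        rw [sub_ne_zero]
        intro h
        have h' : p ^ j = q ^ j := by exact_mod_cast h
        exact hpq (Nat.pow_left_injective (by omega : j ≠ 0) h')
      have := KQ.div_mem hm (hK j)
      rwa [mul_div_cancel_right₀ _ hne0] at this
    · intro l hl
      rw [hco]
      exact KQ.mul_mem (htop l hl) (hK l)

end Weyl

section Dyn
open Topology

theorem unip_poly {V : Type*} [AddCommGroup V] [Module ℝ V] (N : Module.End ℝ V) (D : ℕ)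
    (hN : N ^ D = 0) (l : V →ₗ[ℝ] ℝ) (y : V) :
    ∃ P : ℝ[X], ∀ k : ℕ, l (((1 + N) ^ k) y) = P.eval (k:ℝ) := by
  refine ⟨∑ j ∈ Finset.range D, C (l ((N ^ j) y) / (j.factorial : ℝ)) * descPochhammer ℝ j, fun k => ?_⟩
  rw [Polynomial.eval_finsetSum]
  have hz : ∀ j, D ≤ j → (N ^ j) = 0 := fun j hj => pow_eq_zero_of_le hj hN
  have e1 : l (((1 + N) ^ k) y) = ∑ j ∈ Finset.range (k + 1 + D), (k.choose j : ℝ) * l ((N ^ j) y) := by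
    rw [add_comm, (Commute.one_right N).add_pow]
    simp only [one_pow, mul_one, LinearMap.sum_apply, map_sum]
    rw [← Finset.sum_subset (Finset.range_subset_range.2 (show k + 1 ≤ k + 1 + D by omega))]
    · apply Finset.sum_congr rfl
      intro j _
      rw [← nsmul_eq_mul', LinearMap.smul_apply, map_nsmul, nsmul_eq_mul]
    · intro j _ hj
      rw [Nat.choose_eq_zero_of_lt (by simpa using hj)]
      simp
  rw [e1, ← Finset.sum_subset (Finset.range_subset_range.2 (show D ≤ k + 1 + D by omega))]
  · apply Finset.sum_congr rfl
    intro j _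
    rw [eval_mul, eval_C, descPochhammer_eval_eq_descFactorial, Nat.descFactorial_eq_factorial_mul_choose]
    have : (j.factorial : ℝ) ≠ 0 := by exact_mod_cast j.factorial_ne_zero
    push_cast
    field_simp
  · intro j _ hj
    rw [hz j (by simpa using hj)]
    simp

variable {d : ℕ}

/-- real linear map of the matrix -/
def rlin (A : Matrix (Fin d) (Fin d) ℤ) : Module.End ℝ (Fin d → ℝ) :=
  Matrix.toLinAlgEquiv' ((Int.castRingHom ℝ).mapMatrix A)

theorem rlin_apply (A : Matrix (Fin d) (Fin d) ℤ) (v : Fin d → ℝ) (i : Fin d) :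
    rlin A v i = ∑ j, (A i j : ℝ) * v j := by
  simp [rlin, Matrix.toLinAlgEquiv'_apply, Matrix.mulVec, dotProduct]

theorem rlin_nil (A : Matrix (Fin d) (Fin d) ℤ)
    (hEig : A.charpoly = (X - 1) ^ d ∨ A.charpoly = (X + 1) ^ d) :
    ((rlin A) ^ 2 - 1) ^ d = 0 := by
  have h1 := Matrix.aeval_self_charpoly A
  have h2 : (A ^ 2 - 1) ^ d = 0 := by
    have e1 : A ^ 2 - 1 = (A - 1) * (A + 1) := by noncomm_ring
    have hc : Commute (A - 1) (A + 1) := by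
      unfold Commute SemiconjBy; noncomm_ring
    rw [e1, hc.mul_pow]
    rcases hEig with h | h
    · rw [h] at h1
      simp at h1
      rw [h1, zero_mul]
    · rw [h] at h1
      simp at h1
      rw [h1, mul_zero]
  have h3 := congrArg (fun M => Matrix.toLinAlgEquiv' ((Int.castRingHom ℝ).mapMatrix M)) h2
  simp only [map_pow, map_sub, map_one, map_zero] at h3
  exact h3

/-- linearised affine map -/
def alin (A : Matrix (Fin d) (Fin d) ℤ) (b : Fin d → ℝ) : Module.End ℝ ((Fin d → ℝ) × ℝ) :=
  LinearMap.prod ((rlin A) ∘ₗ LinearMap.fst ℝ _ _ + (LinearMap.toSpanSingleton ℝ _ b) ∘ₗ LinearMap.snd ℝ _ _)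
    (LinearMap.snd ℝ _ _)

theorem alin_apply (A : Matrix (Fin d) (Fin d) ℤ) (b v : Fin d → ℝ) (t : ℝ) :
    alin A b (v, t) = (rlin A v + t • b, t) := by
  simp [alin]

theorem alin_nil (A : Matrix (Fin d) (Fin d) ℤ) (b : Fin d → ℝ)
    (hEig : A.charpoly = (X - 1) ^ d ∨ A.charpoly = (X + 1) ^ d) :
    ((alin A b) ^ 2 - 1) ^ (d + 1) = 0 := by
  set M : Module.End ℝ ((Fin d → ℝ) × ℝ) := (alin A b) ^ 2 - 1 with hM
  set R : Module.End ℝ (Fin d → ℝ) := (rlin A) ^ 2 - 1 with hR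
  have h0 : ∀ v : Fin d → ℝ, M (v, 0) = (R v, 0) := by
    intro v
    simp [hM, hR, pow_two, alin_apply]
  have h1 : ∀ (k : ℕ) (v : Fin d → ℝ), (M ^ k) (v, 0) = ((R ^ k) v, 0) := by
    intro k
    induction k with
    | zero => simp
    | succ k ih => intro v; rw [pow_succ, pow_succ, Module.End.mul_apply, Module.End.mul_apply, h0, ih]
  apply LinearMap.ext
  rintro ⟨v, t⟩
  rw [pow_succ, Module.End.mul_apply]
  have h2 : M (v, t) = ((M (v, t)).1, 0) := by
    ext1
    · rfl
    · simp [hM, pow_two, alin_apply]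
  rw [h2, h1, rlin_nil A hEig]
  simp

def tproj (v : Fin d → ℝ) : Torus d := fun i => (v i : AddCircle (1:ℝ))

theorem tproj_surj (x : Torus d) : ∃ v, tproj v = x := by
  choose v hv using fun i => QuotientAddGroup.mk_surjective (x i)
  exact ⟨v, funext hv⟩

theorem tproj_step (A : Matrix (Fin d) (Fin d) ℤ) (b v : Fin d → ℝ) :
    torusAffine A (tproj b) (tproj v) = tproj (rlin A v + b) := by
  funext i
  simp only [torusAffine, tproj, Pi.add_apply, rlin_apply]
  rw [AddCircle.coe_add]
  congr 1
  have : ∀ s : Finset (Fin d), ((∑ j ∈ s, (A i j : ℝ) * v j : ℝ) : AddCircle (1:ℝ)) =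
      ∑ j ∈ s, A i j • (v j : AddCircle (1:ℝ)) := by
    intro s
    induction s using Finset.induction_on with
    | empty => simp
    | insert j s hj ih =>
      rw [Finset.sum_insert hj, Finset.sum_insert hj, AddCircle.coe_add, ih, ← AddCircle.coe_zsmul, zsmul_eq_mul]
  exact (this _).symm

theorem tproj_iter (A : Matrix (Fin d) (Fin d) ℤ) (b v : Fin d → ℝ) (n : ℕ) :
    (torusAffine A (tproj b))^[n] (tproj v) = tproj (((alin A b) ^ n) (v, 1)).1 ∧
      (((alin A b) ^ n) (v, 1)).2 = 1 := by
  induction n with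
  | zero => simp
  | succ n ih =>
    obtain ⟨h1, h2⟩ := ih
    rw [Function.iterate_succ_apply', h1, tproj_step, pow_succ', Module.End.mul_apply]
    have : ((alin A b) ^ n) (v, 1) = ((((alin A b) ^ n) (v, 1)).1, 1) := by
      ext1
      · rfl
      · exact h2
    generalize hw : (((alin A b) ^ n) (v, 1)).1 = w at *
    rw [this, alin_apply]
    simp

theorem mFourier_tproj (m : Fin d → ℤ) (v : Fin d → ℝ) :
    UnitAddTorus.mFourier m (tproj v) = ee (∑ i, (m i : ℝ) * v i) := by
  have : ∀ s : Finset (Fin d), ∏ i ∈ s, (fourier (m i)) (tproj v i) = ee (∑ i ∈ s, (m i : ℝ) * v i) := by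
    intro s
    induction s using Finset.induction_on with
    | empty => simp [ee]
    | insert j s hj ih =>
      rw [Finset.sum_insert hj, Finset.prod_insert hj, ee_add, ih]
      congr 1
      unfold tproj
      rw [fourier_coe_apply]
      unfold ee
      congr 1
      push_cast
      ring
  exact this Finset.univ

theorem ee_half (n : ℕ) : ee ((n:ℝ) / 2) = (-1) ^ n := by
  have h1 : ee (1 / 2) = -1 := by
    unfold ee
    rw [← Complex.exp_pi_mul_I]
    congr 1
    push_cast
    ring
  induction n with
  | zero => simp [ee]
  | succ n ih =>
    push_cast
    rw [add_div, ee_add, ih, h1, pow_succ]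

theorem mavg_add {F G : ℕ → ℂ} (hF : mavg F) (hG : mavg G) : mavg (fun n => F n + G n) := by
  have := hF.add hG
  rw [add_zero] at this
  refine this.congr fun N => ?_
  rw [← mul_add, ← Finset.sum_add_distrib]
  simp_rw [mul_add]

theorem mavg_smul {F : ℕ → ℂ} (c : ℂ) (hF : mavg F) : mavg (fun n => c * F n) := by
  have := hF.const_mul c
  rw [mul_zero] at this
  refine this.congr fun N => ?_
  rw [mul_left_comm, Finset.mul_sum]
  simp_rw [mul_left_comm c]

theorem mavg_two_poly (F : ℕ → ℂ) (P Q : ℝ[X]) (h0 : ∀ k : ℕ, F (2 * k) = ee (P.eval (k:ℝ)))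
    (h1 : ∀ k : ℕ, F (2 * k + 1) = ee (Q.eval (k:ℝ))) : mavg F := by
  set P' := P.comp (C (1/2) * X) with hP
  set Q' := Q.comp (C (1/2) * X - C (1/2)) with hQ
  set H : ℝ[X] := C (1/2) * X with hH
  have key := mavg_add (mavg_add (mavg_smul (1/2) (mavg_poly P')) (mavg_smul (1/2) (mavg_poly (P' + H))))
    (mavg_add (mavg_smul (1/2) (mavg_poly Q')) (mavg_smul (-1/2) (mavg_poly (Q' + H))))
  have hHe : ∀ n : ℕ, ee (H.eval (n:ℝ)) = (-1) ^ n := by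
    intro n
    rw [← ee_half]
    congr 1
    simp [hH]
    ring
  convert key using 2 with n
  rw [eval_add, eval_add, ee_add, ee_add, hHe]
  rcases Nat.even_or_odd' n with ⟨k, rfl | rfl⟩
  · rw [h0]
    have : P'.eval ((2 * k : ℕ) : ℝ) = P.eval (k:ℝ) := by
      simp [hP, hH]
    rw [this, pow_mul]
    norm_num
    ring
  · rw [h1]
    have : Q'.eval ((2 * k + 1 : ℕ) : ℝ) = Q.eval (k:ℝ) := by
      simp only [hQ, hH, eval_comp, eval_sub, eval_mul, eval_C, eval_X]
      congr 1
      push_cast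
      ring
    rw [this, pow_succ, pow_mul]
    norm_num
    ring

theorem mavg_char_torus (A : Matrix (Fin d) (Fin d) ℤ)
    (hEig : A.charpoly = (X - 1) ^ d ∨ A.charpoly = (X + 1) ^ d) (a x : Torus d) (m : Fin d → ℤ) :
    mavg (fun n => UnitAddTorus.mFourier m ((torusAffine A a)^[n] x)) := by
  obtain ⟨b, rfl⟩ := tproj_surj a
  obtain ⟨v, rfl⟩ := tproj_surj x
  let l : ((Fin d → ℝ) × ℝ) →ₗ[ℝ] ℝ := (∑ i, (m i : ℝ) • LinearMap.proj i) ∘ₗ LinearMap.fst ℝ _ _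
  have hl : ∀ z, l z = ∑ i, (m i : ℝ) * z.1 i := by
    intro z; simp [l]
  have hF : ∀ n, UnitAddTorus.mFourier m ((torusAffine A (tproj b))^[n] (tproj v)) =
      ee (l (((alin A b) ^ n) (v, 1))) := by
    intro n
    rw [(tproj_iter A b v n).1, mFourier_tproj, hl]
  obtain ⟨P, hP⟩ := unip_poly _ _ (alin_nil A b hEig) l (v, 1)
  obtain ⟨Q, hQ⟩ := unip_poly _ _ (alin_nil A b hEig) l (alin A b (v, 1))
  apply mavg_two_poly _ P Q
  · intro k
    rw [hF, ← hP, add_sub_cancel, pow_mul]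
  · intro k
    rw [hF, ← hQ, add_sub_cancel, pow_succ, pow_mul, Module.End.mul_apply]

theorem mavg_torus (A : Matrix (Fin d) (Fin d) ℤ)
    (hEig : A.charpoly = (X - 1) ^ d ∨ A.charpoly = (X + 1) ^ d) (a x : Torus d) (f : C(Torus d, ℂ)) :
    mavg (fun n => f ((torusAffine A a)^[n] x)) := by
  have hspan : ∀ g ∈ Submodule.span ℂ (Set.range (UnitAddTorus.mFourier (d := Fin d))),
      mavg (fun n => g ((torusAffine A a)^[n] x)) := by
    intro g hg
    induction hg using Submodule.span_induction with
    | mem g hg =>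
      obtain ⟨m, rfl⟩ := hg
      exact mavg_char_torus A hEig a x m
    | zero => simp [mavg]
    | add g h _ _ h1 h2 => exact mavg_add h1 h2
    | smul c g _ h => exact mavg_smul c h
  have hf : f ∈ (Submodule.span ℂ (Set.range (UnitAddTorus.mFourier (d := Fin d)))).topologicalClosure := by
    rw [UnitAddTorus.span_mFourier_closure_eq_top]; trivial
  rw [← SetLike.mem_coe, Submodule.topologicalClosure_coe, Metric.mem_closure_iff] at hf
  unfold mavg
  rw [Metric.tendsto_atTop]
  intro ε hε
  obtain ⟨g, hg, hfg⟩ := hf (ε / 2) (by positivity)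
  obtain ⟨N0, hN0⟩ := Metric.tendsto_atTop.1 (hspan g hg) (ε / 2) (by positivity)
  refine ⟨N0, fun N hN => ?_⟩
  have h1 := hN0 N hN
  rw [dist_zero_right] at h1 ⊢
  set y : ℕ → Torus d := fun n => (torusAffine A a)^[n] x
  have e : (1 / N : ℂ) * ∑ n ∈ Finset.Icc 1 N, (ArithmeticFunction.moebius n : ℂ) * f (y n) =
      (1 / N : ℂ) * ∑ n ∈ Finset.Icc 1 N, (ArithmeticFunction.moebius n : ℂ) * g (y n) +
      (1 / N : ℂ) * ∑ n ∈ Finset.Icc 1 N, (ArithmeticFunction.moebius n : ℂ) * (f (y n) - g (y n)) := by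
    rw [← mul_add, ← Finset.sum_add_distrib]
    congr 1
    apply Finset.sum_congr rfl
    intro n _
    ring
  rw [e]
  refine lt_of_le_of_lt (norm_add_le _ _) ?_
  have h2 : ‖(1 / N : ℂ) * ∑ n ∈ Finset.Icc 1 N, (ArithmeticFunction.moebius n : ℂ) * (f (y n) - g (y n))‖ ≤ ε / 2 := by
    have h3 : ‖∑ n ∈ Finset.Icc 1 N, (ArithmeticFunction.moebius n : ℂ) * (f (y n) - g (y n))‖ ≤ N * (ε / 2) := by
      refine (norm_sum_le_of_le _ (fun n _ => (?_ : _ ≤ ε / 2))).trans_eq (by simp)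
      rw [norm_mul, ← dist_eq_norm]
      have h4 := moebius_norm_le n
      have h5 := (ContinuousMap.dist_apply_le_dist (f := f) (g := g) (y n)).trans hfg.le
      calc _ ≤ 1 * (ε / 2) := mul_le_mul h4 h5 dist_nonneg zero_le_one
        _ = _ := one_mul _
    rw [norm_mul, norm_div, norm_one, RCLike.norm_natCast]
    rcases Nat.eq_zero_or_pos N with rfl | hNp
    · simp; positivity
    · have : (0:ℝ) < N := by exact_mod_cast hNp
      rw [one_div, inv_mul_le_iff₀ this]
      exact h3
  linarith

end Dyn


/-- For any `d ≥ 2`, the Möbius sequence is linearly disjoint from every affine distal flow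
`T x = A x + a` on the `d`-torus, i.e. `A ∈ GL(d,ℤ)` with all complex eigenvalues equal
to 1 (charpoly `(X-1)^d`) or all equal to -1 (charpoly `(X+1)^d`), and `a ≠ 0`. -/
theorem moebius_linearlyDisjoint_affineDistal_torus
    (d : ℕ) (hd : 2 ≤ d)
    (A : Matrix (Fin d) (Fin d) ℤ) (hA : IsUnit A.det)
    (hEig : A.charpoly = (X - 1) ^ d ∨ A.charpoly = (X + 1) ^ d)
    (a : Torus d) (ha : a ≠ 0) :
    LinearlyDisjoint (fun n => (ArithmeticFunction.moebius n : ℂ)) (torusAffine A a) := by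
  intro f hf x
  exact mavg_torus A hEig a x ⟨f, hf⟩
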